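/- Let β∈(1,2), s=s₁=1, and let u be three times continuously differentiable on [a,b]. Then there exist constants C₁,C₂>0, possibly depending on a, b, β, λ, g and the values of u, u′, u″, u‴ on [a,b], but independent of M and h, such that for every integer M≥3 the linear system H U_h = F has a unique solution U_h and ‖U−U_h‖ ≤ C₁ h^{3−β} and ‖U−U_h‖_∞ ≤ C₂ h^{3−β}. -/

import Mathlib

open MeasureTheory Set

noncomputable section

/-- Grid spacing `h = (b−a)/(M+1)`. -/
def gH (a b : ℝ) (M : ℕ) : ℝ := (b - a) / (M + 1)

/-- Grid points `x_i = a + i h`, `i = 0,…,M+1`. -/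
def gX (a b : ℝ) (M i : ℕ) : ℝ := a + i * gH a b M

/-- `A₁(i,s,k) = h^{−s−1} ∫_{x_{k−1}}^{x_k} (x_k−y)(x_i−y)^{s−1−β} dy`. -/
def cA1 (a b β : ℝ) (s M i k : ℕ) : ℝ :=
  gH a b M ^ (-(s : ℝ) - 1) *
    ∫ y in gX a b M (k - 1)..gX a b M k,
      (gX a b M k - y) * (gX a b M i - y) ^ ((s : ℝ) - 1 - β)

/-- `A₂(i,s,k) = h^{−s−1} ∫_{x_{k−1}}^{x_k} (y−x_{k−1})(x_i−y)^{s−1−β} dy`. -/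
def cA2 (a b β : ℝ) (s M i k : ℕ) : ℝ :=
  gH a b M ^ (-(s : ℝ) - 1) *
    ∫ y in gX a b M (k - 1)..gX a b M k,
      (y - gX a b M (k - 1)) * (gX a b M i - y) ^ ((s : ℝ) - 1 - β)

/-- `A₃(i,s,k) = h^{−s−1} ∫_{x_{k−1}}^{x_k} (x_k−y)(y−x_i)^{s−1−β} dy`. -/
def cA3 (a b β : ℝ) (s M i k : ℕ) : ℝ :=
  gH a b M ^ (-(s : ℝ) - 1) *
    ∫ y in gX a b M (k - 1)..gX a b M k,
      (gX a b M k - y) * (y - gX a b M i) ^ ((s : ℝ) - 1 - β)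

/-- `A₄(i,s,k) = h^{−s−1} ∫_{x_{k−1}}^{x_k} (y−x_{k−1})(y−x_i)^{s−1−β} dy`. -/
def cA4 (a b β : ℝ) (s M i k : ℕ) : ℝ :=
  gH a b M ^ (-(s : ℝ) - 1) *
    ∫ y in gX a b M (k - 1)..gX a b M k,
      (y - gX a b M (k - 1)) * (y - gX a b M i) ^ ((s : ℝ) - 1 - β)

/-- `B₁(i) = ∫_{−∞}^a e^{λ(y−x_i)} (x_i−y)^{−1−β} dy`. -/
def cB1 (a b β lam : ℝ) (M i : ℕ) : ℝ :=
  ∫ y in Iio a, Real.exp (lam * (y - gX a b M i)) * (gX a b M i - y) ^ (-1 - β)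

/-- `B₂(i) = ∫_b^∞ e^{λ(x_i−y)} (y−x_i)^{−1−β} dy`. -/
def cB2 (a b β lam : ℝ) (M i : ℕ) : ℝ :=
  ∫ y in Ioi b, Real.exp (lam * (gX a b M i - y)) * (y - gX a b M i) ^ (-1 - β)

/-- Off-diagonal entries `h_{i,j}` (in 1-based indexing, `1 ≤ i,j ≤ M`, `i ≠ j`) of the
stiffness matrix. -/
def offD (a b β lam : ℝ) (s s₁ M i j : ℕ) : ℝ :=
  if j + 2 ≤ i then
    -((cA1 a b β s M i (j + 1) + cA2 a b β s M i j) *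
        Real.exp (-lam * ((i : ℝ) - j) * gH a b M) * ((i : ℝ) - j) ^ (-(s : ℝ)))
  else if j + 1 = i then
    -(gH a b M ^ (-β) * Real.exp (-lam * gH a b M) / ((s₁ : ℝ) + 1 - β))
      - cA2 a b β s M i (i - 1) * Real.exp (-lam * gH a b M)
  else if j = i + 1 then
    -(gH a b M ^ (-β) * Real.exp (-lam * gH a b M) / ((s₁ : ℝ) + 1 - β))
      - cA3 a b β s M i (i + 2) * Real.exp (-lam * gH a b M)
  else if i + 2 ≤ j then
    -((cA3 a b β s M i (j + 1) + cA4 a b β s M i j) *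
        Real.exp (-lam * ((j : ℝ) - i) * gH a b M) * ((j : ℝ) - i) ^ (-(s : ℝ)))
  else 0

/-- The prescribed value of `h_{i,i} + Σ_{j≠i} h_{i,j} − B₁(i) − B₂(i)` (1-based index `i`). -/
def diagExtra (a b β lam : ℝ) (s s₁ M i : ℕ) : ℝ :=
  if i = 1 then
    gH a b M ^ (-β) * Real.exp (-lam * gH a b M) / ((s₁ : ℝ) + 1 - β)
      + cA4 a b β s M 1 (M + 1) * Real.exp (-lam * M * gH a b M) * (M : ℝ) ^ (-(s : ℝ))
  else if i = M then
    gH a b M ^ (-β) * Real.exp (-lam * gH a b M) / ((s₁ : ℝ) + 1 - β)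
      + cA1 a b β s M M 1 * Real.exp (-lam * M * gH a b M) * (M : ℝ) ^ (-(s : ℝ))
  else
    cA1 a b β s M i 1 * Real.exp (-lam * i * gH a b M) * (i : ℝ) ^ (-(s : ℝ))
      + cA4 a b β s M i (M + 1) * Real.exp (-lam * ((M : ℝ) + 1 - i) * gH a b M) *
          ((M : ℝ) + 1 - i) ^ (-(s : ℝ))

/-- The `M×M` stiffness matrix `H = (h_{i,j})`: off-diagonal entries given by `offD`, and
diagonal entries defined so that
`h_{i,i} + Σ_{j≠i} h_{i,j} − B₁(i) − B₂(i) = diagExtra i`. -/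
def stiff (a b β lam : ℝ) (s s₁ M : ℕ) : Matrix (Fin M) (Fin M) ℝ :=
  fun i j =>
    if i = j then
      cB1 a b β lam M (i.val + 1) + cB2 a b β lam M (i.val + 1)
        + diagExtra a b β lam s s₁ M (i.val + 1)
        - ∑ k ∈ Finset.univ.erase i, offD a b β lam s s₁ M (i.val + 1) (k.val + 1)
    else offD a b β lam s s₁ M (i.val + 1) (j.val + 1)

/-- `d₁(i) = ∫_{−∞}^a g(y) e^{−λ(x_i−y)} (x_i−y)^{−1−β} dy`. -/
def dd1 (a b β lam : ℝ) (g : ℝ → ℝ) (M i : ℕ) : ℝ :=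
  ∫ y in Iio a, g y * Real.exp (-lam * (gX a b M i - y)) * (gX a b M i - y) ^ (-1 - β)

/-- `d₂(i) = ∫_b^∞ g(y) e^{−λ(y−x_i)} (y−x_i)^{−1−β} dy`. -/
def dd2 (a b β lam : ℝ) (g : ℝ → ℝ) (M i : ℕ) : ℝ :=
  ∫ y in Ioi b, g y * Real.exp (-lam * (y - gX a b M i)) * (y - gX a b M i) ^ (-1 - β)

/-- The load vector `F`. -/
def loadF (a b β lam : ℝ) (s s₁ : ℕ) (f g u : ℝ → ℝ) (M : ℕ) : Fin M → ℝ :=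
  fun i =>
    f (gX a b M (i.val + 1)) + dd1 a b β lam g M (i.val + 1) + dd2 a b β lam g M (i.val + 1)
      + (if i.val + 1 = 1 then
            gH a b M ^ (-β) * Real.exp (-lam * gH a b M) / ((s₁ : ℝ) + 1 - β)
          else
            cA1 a b β s M (i.val + 1) 1 * Real.exp (-lam * ((i.val : ℝ) + 1) * gH a b M) *
              ((i.val : ℝ) + 1) ^ (-(s : ℝ))) * u a
      + (if i.val + 1 = M then
            gH a b M ^ (-β) * Real.exp (-lam * gH a b M) / ((s₁ : ℝ) + 1 - β)
          else
            cA4 a b β s M (i.val + 1) (M + 1) *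
              Real.exp (-lam * ((M : ℝ) - i.val) * gH a b M) *
              ((M : ℝ) - (i.val : ℝ)) ^ (-(s : ℝ))) * u b

/-- The discrete `L²` norm `‖v‖ = (h Σᵢ vᵢ²)^{1/2}`. -/
def dnorm2 (a b : ℝ) (M : ℕ) (v : Fin M → ℝ) : ℝ :=
  Real.sqrt (gH a b M * ∑ i, v i ^ 2)

end

noncomputable section

/-- The error of linear interpolation, multiplied by the length of the interval. -/
theorem linear_interp_error_le {χ χ' χ'' : ℝ → ℝ} {K p q t : ℝ}
    (hc : ContinuousOn χ (Icc p q))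
    (h1 : ∀ x ∈ Ioo p q, HasDerivAt χ (χ' x) x)
    (h2 : ∀ x ∈ Ioo p q, HasDerivAt χ' (χ'' x) x)
    (hK : ∀ x ∈ Ioo p q, -(2 * K) ≤ χ'' x) (hpt : p ≤ t) (htq : t ≤ q) :
    (q - p) * χ t - ((q - t) * χ p + (t - p) * χ q) ≤ K * (t - p) * (q - t) * (q - p) := by
  rcases (hpt.trans htq).eq_or_lt with h | h
  · have h3 : t = p := by linarith
    subst h3; subst h; simp
  have hconv : ConvexOn ℝ (Icc p q) (fun x => χ x + K * x ^ 2) := by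
    refine convexOn_of_hasDerivWithinAt2_nonneg (convex_Icc p q) (by fun_prop)
      (f' := fun x => χ' x + K * (2 * x)) (f'' := fun x => χ'' x + K * 2) ?_ ?_ ?_
    · intro x hx
      rw [interior_Icc] at hx
      refine HasDerivAt.hasDerivWithinAt ((h1 x hx).add ?_)
      simpa using (hasDerivAt_pow 2 x).const_mul K
    · intro x hx
      rw [interior_Icc] at hx
      refine HasDerivAt.hasDerivWithinAt ((h2 x hx).add ?_)
      simpa using ((hasDerivAt_id x).const_mul 2).const_mul K
    · intro x hx
      rw [interior_Icc] at hx
      linarith [hK x hx]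
  have hqp : 0 < q - p := by linarith
  have hw₁ : 0 ≤ (q - t) / (q - p) := div_nonneg (by linarith) hqp.le
  have hw₂ : 0 ≤ (t - p) / (q - p) := div_nonneg (by linarith) hqp.le
  have key := hconv.2 (left_mem_Icc.2 h.le) (right_mem_Icc.2 h.le) hw₁ hw₂
    (by field_simp; ring)
  have ht : (q - t) / (q - p) * p + (t - p) / (q - p) * q = t := by
    field_simp; ring
  simp only [smul_eq_mul] at key
  rw [ht] at key
  have := mul_le_mul_of_nonneg_left key hqp.le
  have e : (q - p) * ((q - t) / (q - p) * (χ p + K * p ^ 2)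
      + (t - p) / (q - p) * (χ q + K * q ^ 2))
      = (q - t) * (χ p + K * p ^ 2) + (t - p) * (χ q + K * q ^ 2) := by
    field_simp
  rw [e] at this
  nlinarith

theorem abs_linear_interp_error_le {χ χ' χ'' : ℝ → ℝ} {K p q t : ℝ}
    (hc : ContinuousOn χ (Icc p q))
    (h1 : ∀ x ∈ Ioo p q, HasDerivAt χ (χ' x) x)
    (h2 : ∀ x ∈ Ioo p q, HasDerivAt χ' (χ'' x) x)
    (hK : ∀ x ∈ Ioo p q, |χ'' x| ≤ 2 * K) (hpt : p ≤ t) (htq : t ≤ q) :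
    |(q - p) * χ t - ((q - t) * χ p + (t - p) * χ q)|
      ≤ K * (t - p) * (q - t) * (q - p) := by
  have a1 := linear_interp_error_le hc h1 h2 (fun x hx => (abs_le.1 (hK x hx)).1) hpt htq
  have a2 := linear_interp_error_le (χ := fun x => -χ x) hc.neg (fun x hx => (h1 x hx).neg)
    (fun x hx => (h2 x hx).neg) (K := K)
    (fun x hx => by linarith [(abs_le.1 (hK x hx)).2]) hpt htq
  rw [abs_le]
  constructor <;> linarith

/-- Derivatives up to order three of a `C³` function on a compact interval, with a common bound. -/
theorem exists_bounded_derivs {a b : ℝ} (hab : a < b) {u : ℝ → ℝ}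
    (hu : ContDiffOn ℝ 3 u (Icc a b)) :
    ∃ u₁ u₂ u₃ : ℝ → ℝ, ∃ K : ℝ, 0 < K ∧ ContinuousOn u₁ (Icc a b) ∧
      (∀ x ∈ Ioo a b, HasDerivAt u (u₁ x) x) ∧ (∀ x ∈ Ioo a b, HasDerivAt u₁ (u₂ x) x) ∧
      (∀ x ∈ Ioo a b, HasDerivAt u₂ (u₃ x) x) ∧
      (∀ x ∈ Icc a b, |u₁ x| ≤ K) ∧ (∀ x ∈ Icc a b, |u₂ x| ≤ K) ∧
      (∀ x ∈ Icc a b, |u₃ x| ≤ K) := by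
  have hU := uniqueDiffOn_Icc hab
  have hcont : ∀ k : ℕ, k ≤ 3 → ContinuousOn (iteratedDerivWithin k u (Icc a b)) (Icc a b) :=
    fun k hk => hu.continuousOn_iteratedDerivWithin (by exact_mod_cast hk) hU
  have hder : ∀ k : ℕ, k < 3 → ∀ x ∈ Ioo a b, HasDerivAt (iteratedDerivWithin k u (Icc a b))
      (iteratedDerivWithin (k + 1) u (Icc a b) x) x := by
    intro k hk x hx
    have hd := hu.differentiableOn_iteratedDerivWithin (m := k) (by exact_mod_cast hk) hU
      x (Ioo_subset_Icc_self hx)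
    rw [iteratedDerivWithin_succ]
    exact hd.hasDerivWithinAt.hasDerivAt (Icc_mem_nhds hx.1 hx.2)
  obtain ⟨K₁, h₁⟩ := isCompact_Icc.exists_bound_of_continuousOn (hcont 1 (by norm_num))
  obtain ⟨K₂, h₂⟩ := isCompact_Icc.exists_bound_of_continuousOn (hcont 2 (by norm_num))
  obtain ⟨K₃, h₃⟩ := isCompact_Icc.exists_bound_of_continuousOn (hcont 3 (by norm_num))
  refine ⟨_, _, _, |K₁| + |K₂| + |K₃| + 1, by positivity, hcont 1 (by norm_num), ?_,
    hder 1 (by norm_num), hder 2 (by norm_num), ?_, ?_, ?_⟩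
  · simpa using hder 0 (by norm_num)
  all_goals
    intro x hx
    have e1 := h₁ x hx
    have e2 := h₂ x hx
    have e3 := h₃ x hx
    rw [Real.norm_eq_abs] at e1 e2 e3
    have := le_abs_self K₁
    have := le_abs_self K₂
    have := le_abs_self K₃
    have := abs_nonneg K₁
    have := abs_nonneg K₂
    have := abs_nonneg K₃
    linarith

/-- Linear interpolation of `Φ` at any two nodes of `[0, L]` is of second order. -/
def InterpBound (Φ : ℝ → ℝ) (K L : ℝ) : Prop :=
  ∀ p t q : ℝ, 0 ≤ p → p ≤ t → t ≤ q → q ≤ L →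
    |(q - p) * Φ t - ((q - t) * Φ p + (t - p) * Φ q)| ≤ K * (t - p) * (q - t) * (q - p)

/-- The tempered divided difference `e^{-λt} (u(x+σt) - u(x))/t`, extended to `t = 0`. -/
def temperedQuot (u₁ : ℝ → ℝ) (lam x σ t : ℝ) : ℝ :=
  ∫ θ in (0 : ℝ)..1, Real.exp (-lam * t) * (σ * u₁ (x + σ * (θ * t)))

section TemperedQuot

variable {a b lam x σ L K : ℝ} {u u₁ u₂ u₃ : ℝ → ℝ}

theorem segment_mem_Icc (hx : x ∈ Ioo a b) (hL : x + σ * L ∈ Icc a b) {r : ℝ}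
    (hr : 0 ≤ r) (hrL : r ≤ L) : x + σ * r ∈ Icc a b := by
  rcases hr.eq_or_lt with h | h
  · subst h; simpa using Ioo_subset_Icc_self hx
  have hL0 : 0 < L := h.trans_le hrL
  obtain ⟨h1, h2⟩ := hL
  rcases le_total 0 σ with hs | hs
  · exact ⟨by nlinarith [hx.1], by nlinarith⟩
  · exact ⟨by nlinarith, by nlinarith [hx.2]⟩

theorem segment_mem_Ioo (hx : x ∈ Ioo a b) (hL : x + σ * L ∈ Icc a b) {r : ℝ}
    (hr : 0 ≤ r) (hrL : r < L) : x + σ * r ∈ Ioo a b := by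
  have hL0 : 0 < L := hr.trans_lt hrL
  obtain ⟨h1, h2⟩ := hL
  rcases le_total 0 σ with hs | hs
  · refine ⟨by nlinarith [hx.1], ?_⟩
    rcases hs.eq_or_lt with h | h
    · subst h; simpa using hx.2
    · nlinarith
  · refine ⟨?_, by nlinarith [hx.2]⟩
    rcases hs.eq_or_lt with h | h
    · subst h; simpa using hx.1
    · nlinarith

theorem temperedQuot_zero : temperedQuot u₁ lam x σ 0 = σ * u₁ x := by
  simp [temperedQuot]

theorem continuousOn_comp_segment (hx : x ∈ Ioo a b) (hL : x + σ * L ∈ Icc a b)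
    (hc : ContinuousOn u₁ (Icc a b)) {t : ℝ} (ht : 0 ≤ t) (htL : t ≤ L) :
    ContinuousOn (fun θ => u₁ (x + σ * (θ * t))) (Icc (0 : ℝ) 1) := by
  refine hc.comp (by fun_prop) ?_
  intro θ hθ
  exact segment_mem_Icc hx hL (mul_nonneg hθ.1 ht)
    ((mul_le_of_le_one_left ht hθ.2).trans htL)

theorem intervalIntegrable_temperedQuot (hx : x ∈ Ioo a b) (hL : x + σ * L ∈ Icc a b)
    (hc : ContinuousOn u₁ (Icc a b)) {t : ℝ} (ht : 0 ≤ t) (htL : t ≤ L) :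
    IntervalIntegrable (fun θ => Real.exp (-lam * t) * (σ * u₁ (x + σ * (θ * t))))
      volume 0 1 :=
  (((continuousOn_comp_segment hx hL hc ht htL).const_mul σ).const_mul
    (Real.exp (-lam * t))).intervalIntegrable_of_Icc zero_le_one

theorem mul_temperedQuot (hx : x ∈ Ioo a b) (hL : x + σ * L ∈ Icc a b)
    (hu : ContinuousOn u (Icc a b)) (hc : ContinuousOn u₁ (Icc a b))
    (h1 : ∀ x ∈ Ioo a b, HasDerivAt u (u₁ x) x) {t : ℝ} (ht : 0 ≤ t) (htL : t ≤ L) :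
    t * temperedQuot u₁ lam x σ t = Real.exp (-lam * t) * (u (x + σ * t) - u x) := by
  rcases ht.eq_or_lt with h | h
  · subst h; simp
  have key : ∫ θ in (0 : ℝ)..1, u₁ (x + σ * (θ * t)) * (σ * t)
      = u (x + σ * (1 * t)) - u (x + σ * (0 * t)) := by
    refine intervalIntegral.integral_eq_sub_of_hasDerivAt_of_le zero_le_one
      (f := fun θ => u (x + σ * (θ * t)))
      (continuousOn_comp_segment hx hL hu ht htL) ?_
      ((continuousOn_comp_segment hx hL hc ht htL).mul_const _
        |>.intervalIntegrable_of_Icc zero_le_one)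
    intro θ hθ
    have hmem : x + σ * (θ * t) ∈ Ioo a b :=
      segment_mem_Ioo hx hL (mul_nonneg hθ.1.le ht)
        ((mul_lt_of_lt_one_left h hθ.2).trans_le htL)
    have hin : HasDerivAt (fun θ => x + σ * (θ * t)) (σ * t) θ := by
      simpa using (((hasDerivAt_id θ).mul_const t).const_mul σ).const_add x
    exact (h1 _ hmem).comp θ hin
  simp only [one_mul, zero_mul, mul_zero, add_zero] at key
  rw [temperedQuot, ← key, ← intervalIntegral.integral_const_mul,
    ← intervalIntegral.integral_const_mul]
  congr 1
  ext θ
  ring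

theorem abs_temperedQuot_le (hx : x ∈ Ioo a b) (hL : x + σ * L ∈ Icc a b) (hlam : 0 ≤ lam)
    (hσ : |σ| = 1) (hK : ∀ x ∈ Icc a b, |u₁ x| ≤ K) {t : ℝ} (ht : 0 ≤ t) (htL : t ≤ L) :
    |temperedQuot u₁ lam x σ t| ≤ K := by
  have := intervalIntegral.norm_integral_le_of_norm_le_const (a := 0) (b := 1) (C := K)
    (f := fun θ => Real.exp (-lam * t) * (σ * u₁ (x + σ * (θ * t)))) ?_
  · simpa [temperedQuot] using this
  intro θ hθ
  rw [uIoc_of_le zero_le_one] at hθ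
  have hm : x + σ * (θ * t) ∈ Icc a b :=
    segment_mem_Icc hx hL (mul_nonneg hθ.1.le ht)
      ((mul_le_of_le_one_left ht hθ.2).trans htL)
  have he : Real.exp (-lam * t) ≤ 1 := Real.exp_le_one_iff.2 (by nlinarith)
  rw [Real.norm_eq_abs, abs_mul, abs_mul, hσ, one_mul, abs_of_pos (Real.exp_pos _)]
  nlinarith [hK _ hm, abs_nonneg (u₁ (x + σ * (θ * t))), Real.exp_pos (-lam * t)]

theorem interpBound_temperedQuot (hx : x ∈ Ioo a b) (hL : x + σ * L ∈ Icc a b)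
    (hlam : 0 ≤ lam) (hσ : |σ| = 1) (hc : ContinuousOn u₁ (Icc a b))
    (h2 : ∀ x ∈ Ioo a b, HasDerivAt u₁ (u₂ x) x)
    (h3 : ∀ x ∈ Ioo a b, HasDerivAt u₂ (u₃ x) x)
    (hK1 : ∀ x ∈ Icc a b, |u₁ x| ≤ K) (hK2 : ∀ x ∈ Icc a b, |u₂ x| ≤ K)
    (hK3 : ∀ x ∈ Icc a b, |u₃ x| ≤ K) :
    InterpBound (temperedQuot u₁ lam x σ) ((lam + 1) ^ 2 * K) L := by
  have hσ2 : σ * σ = 1 := by rw [← abs_mul_abs_self, hσ, one_mul]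
  intro p t q hp hpt htq hqL
  have hpI := intervalIntegrable_temperedQuot (lam := lam) hx hL hc hp (by linarith)
  have htI := intervalIntegrable_temperedQuot (lam := lam) hx hL hc (t := t) (by linarith)
    (by linarith)
  have hqI := intervalIntegrable_temperedQuot (lam := lam) hx hL hc (t := q) (by linarith) hqL
  unfold temperedQuot
  rw [← intervalIntegral.integral_const_mul, ← intervalIntegral.integral_const_mul,
    ← intervalIntegral.integral_const_mul,
    ← intervalIntegral.integral_add (hpI.const_mul _) (hqI.const_mul _),
    ← intervalIntegral.integral_sub (htI.const_mul _)
      ((hpI.const_mul _).add (hqI.const_mul _))]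
  have := intervalIntegral.norm_integral_le_of_norm_le_const (a := 0) (b := 1)
    (C := (lam + 1) ^ 2 * K * (t - p) * (q - t) * (q - p))
    (f := fun θ => (q - p) * (Real.exp (-lam * t) * (σ * u₁ (x + σ * (θ * t))))
      - ((q - t) * (Real.exp (-lam * p) * (σ * u₁ (x + σ * (θ * p))))
        + (t - p) * (Real.exp (-lam * q) * (σ * u₁ (x + σ * (θ * q)))))) ?_
  · simpa using this
  intro θ hθ
  rw [uIoc_of_le zero_le_one] at hθ
  rw [Real.norm_eq_abs]
  have hexp : ∀ y, HasDerivAt (fun y => Real.exp (-lam * y)) (Real.exp (-lam * y) * -lam) y := by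
    intro y
    simpa using ((hasDerivAt_id y).const_mul (-lam)).exp
  have hin : ∀ y, HasDerivAt (fun y => x + σ * (θ * y)) (σ * θ) y := by
    intro y
    simpa using (((hasDerivAt_id y).const_mul θ).const_mul σ).const_add x
  have hmem : ∀ y ∈ Ioo p q, x + σ * (θ * y) ∈ Ioo a b := by
    intro y hy
    have hy0 : 0 ≤ y := hp.trans hy.1.le
    exact segment_mem_Ioo hx hL (mul_nonneg hθ.1.le hy0)
      ((mul_le_of_le_one_left hy0 hθ.2).trans_lt (hy.2.trans_le hqL))
  refine abs_linear_interp_error_le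
    (χ := fun y => Real.exp (-lam * y) * (σ * u₁ (x + σ * (θ * y))))
    (χ' := fun y => Real.exp (-lam * y) * (-lam) * (σ * u₁ (x + σ * (θ * y)))
      + Real.exp (-lam * y) * (σ * (u₂ (x + σ * (θ * y)) * (σ * θ))))
    (χ'' := fun y => (Real.exp (-lam * y) * (-lam) * (-lam) * (σ * u₁ (x + σ * (θ * y)))
        + Real.exp (-lam * y) * (-lam) * (σ * (u₂ (x + σ * (θ * y)) * (σ * θ))))
      + (Real.exp (-lam * y) * (-lam) * (σ * (u₂ (x + σ * (θ * y)) * (σ * θ)))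
        + Real.exp (-lam * y) * (σ * (u₃ (x + σ * (θ * y)) * (σ * θ) * (σ * θ)))))
    ?_ ?_ ?_ ?_ hpt htq
  · refine ContinuousOn.mul (by fun_prop) (ContinuousOn.mul (by fun_prop) ?_)
    refine hc.comp (by fun_prop) ?_
    intro y hy
    have hy0 : 0 ≤ y := hp.trans hy.1
    exact segment_mem_Icc hx hL (mul_nonneg hθ.1.le hy0)
      ((mul_le_of_le_one_left hy0 hθ.2).trans (hy.2.trans hqL))
  · intro y hy
    exact (hexp y).mul (((h2 _ (hmem y hy)).comp y (hin y)).const_mul σ)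
  · intro y hy
    exact (((hexp y).mul_const (-lam)).mul (((h2 _ (hmem y hy)).comp y (hin y)).const_mul σ)).add
      ((hexp y).mul ((((h3 _ (hmem y hy)).comp y (hin y)).mul_const (σ * θ)).const_mul σ))
  · intro y hy
    have hm := Ioo_subset_Icc_self (hmem y hy)
    have e1 := hK1 _ hm
    have e2 := hK2 _ hm
    have e3 := hK3 _ hm
    set z := x + σ * (θ * y)
    have he1 : Real.exp (-lam * y) ≤ 1 := Real.exp_le_one_iff.2 (by nlinarith [hp.trans hy.1.le])
    have he0 := Real.exp_pos (-lam * y)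
    have hK0 : 0 ≤ K := (abs_nonneg _).trans e1
    have hθ0 := hθ.1.le
    have hθ1 := hθ.2
    have hrw : (Real.exp (-lam * y) * (-lam) * (-lam) * (σ * u₁ z)
          + Real.exp (-lam * y) * (-lam) * (σ * (u₂ z * (σ * θ))))
        + (Real.exp (-lam * y) * (-lam) * (σ * (u₂ z * (σ * θ)))
          + Real.exp (-lam * y) * (σ * (u₃ z * (σ * θ) * (σ * θ))))
        = Real.exp (-lam * y) * (lam ^ 2 * (σ * u₁ z) - 2 * lam * θ * u₂ z
          + θ ^ 2 * (σ * u₃ z)) := by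
      linear_combination (Real.exp (-lam * y)) * (-2 * lam * θ * u₂ z + θ ^ 2 * σ * u₃ z) * hσ2
    rw [hrw, abs_mul, abs_of_pos he0]
    have hb : |lam ^ 2 * (σ * u₁ z) - 2 * lam * θ * u₂ z + θ ^ 2 * (σ * u₃ z)|
        ≤ (lam + 1) ^ 2 * K := by
      have a1 : |lam ^ 2 * (σ * u₁ z)| ≤ lam ^ 2 * K := by
        rw [abs_mul, abs_mul, hσ, one_mul, abs_of_nonneg (sq_nonneg _)]
        gcongr
      have a2 : |2 * lam * θ * u₂ z| ≤ 2 * lam * 1 * K := by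
        rw [abs_mul, abs_of_nonneg (by positivity)]
        gcongr
      have a3 : |θ ^ 2 * (σ * u₃ z)| ≤ 1 * K := by
        rw [abs_mul, abs_mul, hσ, one_mul, abs_of_nonneg (sq_nonneg _)]
        gcongr
        exact pow_le_one₀ hθ0 hθ1
      calc _ ≤ |lam ^ 2 * (σ * u₁ z)| + |2 * lam * θ * u₂ z| + |θ ^ 2 * (σ * u₃ z)| :=
            (abs_add_le _ _).trans (by gcongr; exact abs_sub _ _)
        _ ≤ _ := by linarith
    have : 0 ≤ (lam + 1) ^ 2 * K := by positivity
    nlinarith [abs_nonneg (lam ^ 2 * (σ * u₁ z) - 2 * lam * θ * u₂ z + θ ^ 2 * (σ * u₃ z))]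

end TemperedQuot

end

noncomputable section

/-- Weight of the right node of the cell `[kh, (k+1)h]` for the kernel `t^{-β}`. -/
def rightWeight (β h : ℝ) (k : ℕ) : ℝ :=
  (h ^ 2)⁻¹ * ∫ t in (k * h)..((k + 1) * h), (t - k * h) * t ^ (-β)

/-- Weight of the left node of the cell `[kh, (k+1)h]` for the kernel `t^{-β}`. -/
def leftWeight (β h : ℝ) (k : ℕ) : ℝ :=
  (h ^ 2)⁻¹ * ∫ t in (k * h)..((k + 1) * h), ((k + 1) * h - t) * t ^ (-β)

section Quadrature

variable {β h K L : ℝ} {Φ : ℝ → ℝ}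

theorem rightWeight_nonneg (hh : 0 ≤ h) (k : ℕ) : 0 ≤ rightWeight β h k := by
  refine mul_nonneg (by positivity) (intervalIntegral.integral_nonneg (by nlinarith) ?_)
  intro t ht
  have : 0 ≤ (k : ℝ) * h := by positivity
  exact mul_nonneg (by linarith [ht.1]) (Real.rpow_nonneg (this.trans ht.1) _)

theorem leftWeight_nonneg (hh : 0 ≤ h) (k : ℕ) : 0 ≤ leftWeight β h k := by
  refine mul_nonneg (by positivity) (intervalIntegral.integral_nonneg (by nlinarith) ?_)
  intro t ht
  have : 0 ≤ (k : ℝ) * h := by positivity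
  exact mul_nonneg (by linarith [ht.2]) (Real.rpow_nonneg (this.trans ht.1) _)

theorem continuousOn_rpow_Icc {r q : ℝ} (hr : 0 < r) (s : ℝ) :
    ContinuousOn (fun t : ℝ => t ^ s) (Icc r q) := by
  intro t ht
  exact (Real.continuousAt_rpow_const t s (Or.inl (hr.trans_le ht.1).ne')).continuousWithinAt

theorem mul_rpow_neg_eq (hβ : β ∈ Ioo (1 : ℝ) 2) {t : ℝ} (ht : 0 ≤ t) :
    t * t ^ (-β) = t ^ (1 - β) := by
  rcases ht.eq_or_lt with h | h
  · subst h
    rw [zero_mul, Real.zero_rpow (by linarith [hβ.1])]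
  · rw [sub_eq_add_neg, Real.rpow_add h, Real.rpow_one]

theorem integral_mul_rpow_neg (hβ : β ∈ Ioo (1 : ℝ) 2) {r q : ℝ} (hr : 0 ≤ r) (hrq : r ≤ q) :
    ∫ t in r..q, t * t ^ (-β) = (q ^ (2 - β) - r ^ (2 - β)) / (2 - β) := by
  have : ∫ t in r..q, t * t ^ (-β) = ∫ t in r..q, t ^ (1 - β) := by
    refine intervalIntegral.integral_congr fun t ht => ?_
    rw [uIcc_of_le hrq] at ht
    exact mul_rpow_neg_eq hβ (hr.trans ht.1)
  rw [this, integral_rpow (Or.inl (by linarith [hβ.2])), show 1 - β + 1 = 2 - β by ring]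

theorem rightWeight_zero (hβ : β ∈ Ioo (1 : ℝ) 2) (hh : 0 < h) :
    rightWeight β h 0 = (h ^ 2)⁻¹ * (h ^ (2 - β) / (2 - β)) := by
  have := integral_mul_rpow_neg hβ le_rfl hh.le
  rw [Real.zero_rpow (by linarith [hβ.2]), sub_zero] at this
  simp [rightWeight, this]

theorem integral_rpow_neg_le (hβ : β ∈ Ioo (1 : ℝ) 2) (hh : 0 < h) {q : ℝ} (hq : h ≤ q) :
    ∫ t in h..q, t ^ (-β) ≤ h ^ (1 - β) / (β - 1) := by
  have h0 : (0 : ℝ) ∉ uIcc h q := by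
    rw [uIcc_of_le hq]; exact fun h' => absurd h'.1 (by linarith)
  have h1 := hβ.1
  rw [integral_rpow (Or.inr ⟨by linarith, h0⟩), show -β + 1 = -(β - 1) by ring,
    show 1 - β = -(β - 1) by ring, div_neg, ← neg_div]
  have := Real.rpow_nonneg (hh.le.trans hq) (-(β - 1))
  have h2 : 0 < β - 1 := by linarith
  gcongr
  linarith

theorem cell_error_le (hΦ : InterpBound Φ K L) (hc : ContinuousOn Φ (Ioc 0 L)) {p r q : ℝ}
    (hp : 0 ≤ p) (hr : 0 < r) (hpr : p ≤ r) (hrq : r ≤ q) (hq : q ≤ L) :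
    |(q - p) * (∫ t in r..q, Φ t * t ^ (-β)) - (Φ p * (∫ t in r..q, (q - t) * t ^ (-β))
        + Φ q * ∫ t in r..q, (t - p) * t ^ (-β))|
      ≤ K * (q - p) * ∫ t in r..q, (t - p) * (q - t) * t ^ (-β) := by
  have hcr := continuousOn_rpow_Icc (q := q) hr (-β)
  have hcΦ : ContinuousOn Φ (Icc r q) :=
    hc.mono fun t ht => ⟨hr.trans_le ht.1, ht.2.trans hq⟩
  have i1 : IntervalIntegrable (fun t => Φ t * t ^ (-β)) volume r q :=
    (hcΦ.mul hcr).intervalIntegrable_of_Icc hrq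
  have i2 : IntervalIntegrable (fun t => (q - t) * t ^ (-β)) volume r q :=
    (ContinuousOn.mul (by fun_prop) hcr).intervalIntegrable_of_Icc hrq
  have i3 : IntervalIntegrable (fun t => (t - p) * t ^ (-β)) volume r q :=
    (ContinuousOn.mul (by fun_prop) hcr).intervalIntegrable_of_Icc hrq
  have i4 : IntervalIntegrable (fun t => (t - p) * (q - t) * t ^ (-β)) volume r q :=
    (ContinuousOn.mul (by fun_prop) hcr).intervalIntegrable_of_Icc hrq
  rw [← intervalIntegral.integral_const_mul, ← intervalIntegral.integral_const_mul,
    ← intervalIntegral.integral_const_mul, ← intervalIntegral.integral_const_mul,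
    ← intervalIntegral.integral_add (i2.const_mul _) (i3.const_mul _),
    ← intervalIntegral.integral_sub (i1.const_mul _) ((i2.const_mul _).add (i3.const_mul _))]
  rw [← Real.norm_eq_abs]
  refine intervalIntegral.norm_integral_le_of_norm_le hrq (Filter.Eventually.of_forall ?_)
    (i4.const_mul _)
  intro t ht
  have h1 := hΦ p t q hp (hpr.trans ht.1.le) ht.2 hq
  have h2 : 0 ≤ t ^ (-β) := Real.rpow_nonneg (hr.trans ht.1).le _
  rw [Real.norm_eq_abs]
  calc _ = |((q - p) * Φ t - ((q - t) * Φ p + (t - p) * Φ q)) * t ^ (-β)| := by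
        congr 1; ring
    _ ≤ (K * (t - p) * (q - t) * (q - p)) * t ^ (-β) := by
        rw [abs_mul, abs_of_nonneg h2]; gcongr
    _ = _ := by ring

theorem near_cell_error_le (hβ : β ∈ Ioo (1 : ℝ) 2) (hK : 0 ≤ K) (hΦ : InterpBound Φ K L)
    (hc : ContinuousOn Φ (Ioc 0 L)) {ε : ℝ} (hε : 0 < ε) (hεh : ε ≤ h) (hL : h ≤ L) :
    |(∫ t in ε..h, Φ t * t ^ (-β)) - Φ 0 * (h⁻¹ * ∫ t in ε..h, (h - t) * t ^ (-β))
        - h * (rightWeight β h 0 * Φ h)|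
      ≤ K * h ^ (3 - β) / (2 - β) + |Φ h| * (ε ^ (2 - β) / ((2 - β) * h)) := by
  have hh : 0 < h := hε.trans_le hεh
  have hβ2 : 0 < 2 - β := by linarith [hβ.2]
  have key := cell_error_le (β := β) hΦ hc le_rfl hε hε.le hεh hL
  simp only [sub_zero] at key
  have hJ := integral_mul_rpow_neg hβ hε.le hεh
  have hb : ∫ t in ε..h, t * (h - t) * t ^ (-β) ≤ h * (h ^ (2 - β) / (2 - β)) := by
    have hcr := continuousOn_rpow_Icc (q := h) hε (-β)
    have : ∫ t in ε..h, t * (h - t) * t ^ (-β) ≤ ∫ t in ε..h, h * (t * t ^ (-β)) := by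
      refine intervalIntegral.integral_mono_on hεh
        ((ContinuousOn.mul (by fun_prop) hcr).intervalIntegrable_of_Icc hεh)
        ((ContinuousOn.mul (by fun_prop)
          (ContinuousOn.mul (by fun_prop) hcr)).intervalIntegrable_of_Icc hεh) ?_
      intro t ht
      have h0 : 0 ≤ t := hε.le.trans ht.1
      have h2 : 0 ≤ t * t ^ (-β) := mul_nonneg h0 (Real.rpow_nonneg h0 _)
      nlinarith
    rw [intervalIntegral.integral_const_mul, hJ] at this
    refine this.trans ?_
    gcongr
    linarith [Real.rpow_nonneg hε.le (2 - β)]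
  rw [hJ] at key
  rw [rightWeight_zero hβ hh]
  set I := ∫ t in ε..h, Φ t * t ^ (-β)
  set N := ∫ t in ε..h, (h - t) * t ^ (-β)
  set R := ∫ t in ε..h, t * (h - t) * t ^ (-β)
  have e1 : I - Φ 0 * (h⁻¹ * N) - h * ((h ^ 2)⁻¹ * (h ^ (2 - β) / (2 - β)) * Φ h)
      = h⁻¹ * (h * I - (Φ 0 * N + Φ h * ((h ^ (2 - β) - ε ^ (2 - β)) / (2 - β))))
        - Φ h * (ε ^ (2 - β) / ((2 - β) * h)) := by
    field_simp
    ring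
  rw [e1]
  refine (abs_sub _ _).trans (add_le_add ?_ ?_)
  · rw [abs_mul, abs_of_pos (inv_pos.2 hh)]
    have e3 : h ^ (3 - β) = h * h ^ (2 - β) := by
      rw [show 3 - β = 1 + (2 - β) by ring, Real.rpow_add hh, Real.rpow_one]
    calc _ ≤ h⁻¹ * (K * h * (h * (h ^ (2 - β) / (2 - β)))) := by
          gcongr
          refine key.trans ?_
          gcongr
      _ = _ := by
          rw [e3]; field_simp
  · rw [abs_mul, abs_of_nonneg (a := ε ^ (2 - β) / _)]
    have := Real.rpow_nonneg hε.le (2 - β)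
    positivity

theorem far_cell_error_le (hK : 0 ≤ K) (hh : 0 < h)
    (hΦ : InterpBound Φ K L) (hc : ContinuousOn Φ (Ioc 0 L)) {k : ℕ}
    (hk : 1 ≤ k) (hL : (k + 1) * h ≤ L) :
    |(∫ t in (k * h)..((k + 1) * h), Φ t * t ^ (-β))
        - h * (leftWeight β h k * Φ (k * h) + rightWeight β h k * Φ ((k + 1) * h))|
      ≤ K * h ^ 2 * ∫ t in (k * h)..((k + 1) * h), t ^ (-β) := by
  have hk1 : (1 : ℝ) ≤ k := by exact_mod_cast hk
  have hkh : 0 < (k : ℝ) * h := by positivity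
  have hle : (k : ℝ) * h ≤ (k + 1) * h := by nlinarith
  have key := cell_error_le (β := β) hΦ hc hkh.le hkh le_rfl hle hL
  rw [show ((k : ℝ) + 1) * h - k * h = h by ring] at key
  have hcr := continuousOn_rpow_Icc (q := (k + 1) * h) hkh (-β)
  have hb : ∫ t in (k * h)..((k + 1) * h), (t - k * h) * ((k + 1) * h - t) * t ^ (-β)
      ≤ h ^ 2 * ∫ t in (k * h)..((k + 1) * h), t ^ (-β) := by
    rw [← intervalIntegral.integral_const_mul]
    refine intervalIntegral.integral_mono_on hle
      ((ContinuousOn.mul (by fun_prop) hcr).intervalIntegrable_of_Icc hle)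
      ((ContinuousOn.mul (by fun_prop) hcr).intervalIntegrable_of_Icc hle) ?_
    intro t ht
    have h2 : 0 ≤ t ^ (-β) := Real.rpow_nonneg (hkh.le.trans ht.1) _
    have h3 := ht.1
    have h4 := ht.2
    refine mul_le_mul_of_nonneg_right ?_ h2
    nlinarith
  unfold leftWeight rightWeight
  set I := ∫ t in (k * h)..((k + 1) * h), Φ t * t ^ (-β)
  set A := ∫ t in (k * h)..((k + 1) * h), ((k + 1) * h - t) * t ^ (-β)
  set B := ∫ t in (k * h)..((k + 1) * h), (t - k * h) * t ^ (-β)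
  set R := ∫ t in (k * h)..((k + 1) * h), (t - k * h) * ((k + 1) * h - t) * t ^ (-β)
  set S := ∫ t in (k * h)..((k + 1) * h), t ^ (-β)
  have e1 : I - h * ((h ^ 2)⁻¹ * A * Φ (k * h) + (h ^ 2)⁻¹ * B * Φ ((k + 1) * h))
      = h⁻¹ * (h * I - (Φ (k * h) * A + Φ ((k + 1) * h) * B)) := by
    field_simp
  rw [e1, abs_mul, abs_of_pos (inv_pos.2 hh)]
  calc _ ≤ h⁻¹ * (K * h * (h ^ 2 * S)) := by
        gcongr
        refine key.trans ?_
        gcongr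
    _ = _ := by field_simp

/-- Error of the weighted quadrature rule for `∫_ε^{(m+1)h} Φ(t) t^{-β} dt`; the singular
contribution of `Φ 0` is kept. -/
theorem quadrature_error_le (hβ : β ∈ Ioo (1 : ℝ) 2) (hK : 0 ≤ K) (hΦ : InterpBound Φ K L)
    (hc : ContinuousOn Φ (Ioc 0 L)) {ε : ℝ} (hε : 0 < ε) (hεh : ε ≤ h) (m : ℕ)
    (hL : (m + 1) * h ≤ L) :
    |(∫ t in ε..((m + 1) * h), Φ t * t ^ (-β))
        - Φ 0 * (h⁻¹ * ∫ t in ε..h, (h - t) * t ^ (-β))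
        - h * (∑ j ∈ Finset.range m,
            (rightWeight β h j + leftWeight β h (j + 1)) * Φ ((j + 1) * h)
          + rightWeight β h m * Φ ((m + 1) * h))|
      ≤ K * h ^ (3 - β) / (2 - β) + |Φ h| * (ε ^ (2 - β) / ((2 - β) * h))
        + K * h ^ 2 * ∫ t in h..((m + 1) * h), t ^ (-β) := by
  have hh : 0 < h := hε.trans_le hεh
  induction m with
  | zero =>
    simp only [Nat.cast_zero, zero_add, one_mul] at hL
    have := near_cell_error_le hβ hK hΦ hc hε hεh hL
    simpa using this
  | succ m ih =>
    push_cast at hL ⊢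
    have hL' : ((m : ℝ) + 1) * h ≤ L := by nlinarith
    have h1 := ih hL'
    have h2 := far_cell_error_le (β := β) hK hh hΦ hc (k := m + 1) (by omega)
      (by push_cast; exact hL)
    push_cast at h2
    have hm0 : (0 : ℝ) ≤ m := m.cast_nonneg
    have hhm : h ≤ (m + 1) * h := by nlinarith
    have hmm : ((m : ℝ) + 1) * h ≤ (m + 1 + 1) * h := by nlinarith
    have hi : ∀ r q, 0 < r → r ≤ q → q ≤ L →
        IntervalIntegrable (fun t => Φ t * t ^ (-β)) volume r q := by
      intro r q hr hrq hq
      exact ((hc.mono fun t ht => ⟨hr.trans_le ht.1, ht.2.trans hq⟩).mul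
        (continuousOn_rpow_Icc hr (-β))).intervalIntegrable_of_Icc hrq
    have hi' : ∀ r q : ℝ, 0 < r → r ≤ q →
        IntervalIntegrable (fun t => t ^ (-β)) volume r q := by
      intro r q hr hrq
      exact (continuousOn_rpow_Icc hr (-β)).intervalIntegrable_of_Icc hrq
    have a1 := intervalIntegral.integral_add_adjacent_intervals
      (hi ε ((m + 1) * h) hε (hεh.trans hhm) hL')
      (hi ((m + 1) * h) ((m + 1 + 1) * h) (hh.trans_le hhm) hmm hL)
    have a2 := intervalIntegral.integral_add_adjacent_intervals
      (hi' h ((m + 1) * h) hh hhm) (hi' ((m + 1) * h) ((m + 1 + 1) * h) (hh.trans_le hhm) hmm)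
    rw [← a1, ← a2, Finset.sum_range_succ]
    rw [abs_le] at h1 h2 ⊢
    constructor <;> linarith [h1.1, h1.2, h2.1, h2.2]

end Quadrature

section OneSided

variable {a b lam x σ K β h : ℝ} {u u₁ u₂ u₃ : ℝ → ℝ}

/-- The off-diagonal coefficient of the scheme for nodes at distance `(j+1)h`. -/
def nodeCoeff (β lam h : ℝ) (j : ℕ) : ℝ :=
  (rightWeight β h j + leftWeight β h (j + 1)) * (Real.exp (-lam * ((j + 1) * h)) / (j + 1))

/-- The coefficient of the boundary node at distance `(m+1)h`. -/
def boundaryCoeff (β lam h : ℝ) (m : ℕ) : ℝ :=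
  rightWeight β h m * (Real.exp (-lam * ((m + 1) * h)) / (m + 1))

theorem one_sided_error_le (hβ : β ∈ Ioo (1 : ℝ) 2) (hlam : 0 ≤ lam) (hK : 0 ≤ K)
    (hσ : |σ| = 1) (hu : ContinuousOn u (Icc a b)) (hc : ContinuousOn u₁ (Icc a b))
    (h1 : ∀ x ∈ Ioo a b, HasDerivAt u (u₁ x) x)
    (h2 : ∀ x ∈ Ioo a b, HasDerivAt u₁ (u₂ x) x)
    (h3 : ∀ x ∈ Ioo a b, HasDerivAt u₂ (u₃ x) x)
    (hK1 : ∀ x ∈ Icc a b, |u₁ x| ≤ K) (hK2 : ∀ x ∈ Icc a b, |u₂ x| ≤ K)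
    (hK3 : ∀ x ∈ Icc a b, |u₃ x| ≤ K)
    (hx : x ∈ Ioo a b) (m : ℕ) (hL : x + σ * ((m + 1) * h) ∈ Icc a b)
    {ε : ℝ} (hε : 0 < ε) (hεh : ε ≤ h) :
    |(∫ t in ε..((m + 1) * h), (u x - u (x + σ * t)) * Real.exp (-lam * t) * t ^ (-1 - β))
        + σ * u₁ x * (h⁻¹ * ∫ t in ε..h, (h - t) * t ^ (-β))
        - (∑ j ∈ Finset.range m, nodeCoeff β lam h j * (u x - u (x + σ * ((j + 1) * h)))
          + boundaryCoeff β lam h m * (u x - u (x + σ * ((m + 1) * h))))|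
      ≤ (lam + 1) ^ 2 * K * (1 / (2 - β) + 1 / (β - 1)) * h ^ (3 - β)
        + K * (ε ^ (2 - β) / ((2 - β) * h)) := by
  have hh : 0 < h := hε.trans_le hεh
  have hm0 : (0 : ℝ) ≤ m := m.cast_nonneg
  have hhm : h ≤ (m + 1) * h := by nlinarith
  set L := ((m : ℝ) + 1) * h with hLdef
  have hβ1 : 0 < β - 1 := by linarith [hβ.1]
  have hβ2 : 0 < 2 - β := by linarith [hβ.2]
  set Φ := temperedQuot u₁ lam x σ with hΦdef
  have hmul : ∀ t, 0 ≤ t → t ≤ L → t * Φ t = Real.exp (-lam * t) * (u (x + σ * t) - u x) :=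
    fun t ht htL => mul_temperedQuot hx hL hu hc h1 ht htL
  have hΦ : InterpBound Φ ((lam + 1) ^ 2 * K) L :=
    interpBound_temperedQuot hx hL hlam hσ hc h2 h3 hK1 hK2 hK3
  have hcΦ : ContinuousOn Φ (Ioc 0 L) := by
    have : ContinuousOn (fun t => Real.exp (-lam * t) * (u (x + σ * t) - u x) / t) (Ioc 0 L) := by
      refine ContinuousOn.div (ContinuousOn.mul (by fun_prop) (ContinuousOn.sub ?_ (by fun_prop)))
        (by fun_prop) (fun t ht => ht.1.ne')
      exact hu.comp (by fun_prop) fun t ht => segment_mem_Icc hx hL ht.1.le ht.2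
    refine this.congr fun t ht => ?_
    show Φ t = Real.exp (-lam * t) * (u (x + σ * t) - u x) / t
    rw [← hmul t ht.1.le ht.2, mul_div_cancel_left₀ _ ht.1.ne']
  have key := quadrature_error_le hβ (K := (lam + 1) ^ 2 * K) (by positivity) hΦ hcΦ hε hεh m le_rfl
  have hint : ∫ t in ε..L, (u x - u (x + σ * t)) * Real.exp (-lam * t) * t ^ (-1 - β)
      = -∫ t in ε..L, Φ t * t ^ (-β) := by
    rw [← intervalIntegral.integral_neg]
    refine intervalIntegral.integral_congr fun t ht => ?_
    rw [uIcc_of_le (hεh.trans hhm)] at ht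
    have ht0 : 0 < t := hε.trans_le ht.1
    have e1 : t ^ (-β) = t * t ^ (-1 - β) := by
      rw [show -β = 1 + (-1 - β) by ring, Real.rpow_add ht0, Real.rpow_one]
    show (u x - u (x + σ * t)) * Real.exp (-lam * t) * t ^ (-1 - β) = -(Φ t * t ^ (-β))
    rw [e1]
    linear_combination t ^ (-1 - β) * hmul t ht0.le ht.2
  have hnode : ∀ j : ℕ, ((j : ℝ) + 1) * h ≤ L →
      Real.exp (-lam * ((j + 1) * h)) / (j + 1) * (u x - u (x + σ * ((j + 1) * h)))
        = -(h * Φ ((j + 1) * h)) := by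
    intro j hj
    have := hmul (((j : ℝ) + 1) * h) (by positivity) hj
    have hj0 : (j : ℝ) + 1 ≠ 0 := by positivity
    rw [div_mul_eq_mul_div, div_eq_iff hj0]
    linear_combination this
  have hsum : ∑ j ∈ Finset.range m, nodeCoeff β lam h j * (u x - u (x + σ * ((j + 1) * h)))
        + boundaryCoeff β lam h m * (u x - u (x + σ * L))
      = -(h * (∑ j ∈ Finset.range m,
            (rightWeight β h j + leftWeight β h (j + 1)) * Φ ((j + 1) * h)
          + rightWeight β h m * Φ L)) := by
    have hb := hnode m le_rfl
    rw [mul_add, neg_add, Finset.mul_sum, ← Finset.sum_neg_distrib]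
    congr 1
    · refine Finset.sum_congr rfl fun j hj => ?_
      have hjm : (j : ℝ) ≤ m := by exact_mod_cast (Finset.mem_range.1 hj).le
      have := hnode j (by rw [hLdef]; gcongr)
      unfold nodeCoeff
      linear_combination (rightWeight β h j + leftWeight β h (j + 1)) * this
    · unfold boundaryCoeff
      rw [hLdef]
      linear_combination rightWeight β h m * hb
  rw [hint, hsum, ← temperedQuot_zero (u₁ := u₁) (lam := lam) (x := x) (σ := σ), ← hΦdef, ← abs_neg]
  have hΦh : |Φ h| ≤ K := abs_temperedQuot_le hx hL hlam hσ hK1 hh.le hhm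
  have hI := integral_rpow_neg_le hβ hh hhm
  have e3 : h ^ (3 - β) = h ^ 2 * h ^ (1 - β) := by
    rw [show 3 - β = 2 + (1 - β) by ring, Real.rpow_add hh, Real.rpow_two]
  have hεp : 0 ≤ ε ^ (2 - β) / ((2 - β) * h) := by
    have := Real.rpow_nonneg hε.le (2 - β)
    positivity
  calc _ = _ := by congr 1; ring
    _ ≤ _ := key
    _ ≤ (lam + 1) ^ 2 * K * h ^ (3 - β) / (2 - β) + K * (ε ^ (2 - β) / ((2 - β) * h))
        + (lam + 1) ^ 2 * K * h ^ 2 * (h ^ (1 - β) / (β - 1)) := by gcongr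
    _ = _ := by rw [e3]; ring

end OneSided

end

noncomputable section

section Consistency

variable {a b lam x β : ℝ} {u g : ℝ → ℝ}

theorem integrableOn_Ioi_kernel (hβ : 0 < β) (hlam : 0 ≤ lam) (hx : x < b) :
    IntegrableOn (fun y => Real.exp (-lam * |x - y|) * |x - y| ^ (-1 - β)) (Ioi b) := by
  have h0 : IntegrableOn (fun y => (y - x) ^ (-1 - β)) (Ioi b) := by
    have := (measurePreserving_sub_right volume x).integrableOn_comp_preimage
      (Homeomorph.subRight x).measurableEmbedding (f := fun t : ℝ => t ^ (-1 - β))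
      (s := Ioi (b - x))
    have h1 := this.2 (integrableOn_Ioi_rpow_of_lt (by linarith) (by linarith))
    simpa [Function.comp_def] using h1
  refine Integrable.mono' h0 (by fun_prop) ?_
  refine (ae_restrict_iff' measurableSet_Ioi).2 (Filter.Eventually.of_forall fun y hy => ?_)
  have hyx : 0 < y - x := by have := mem_Ioi.1 hy; linarith
  rw [abs_sub_comm, abs_of_pos hyx, Real.norm_eq_abs]
  have e1 : Real.exp (-lam * (y - x)) ≤ 1 := Real.exp_le_one_iff.2 (by nlinarith)
  have e2 := Real.rpow_nonneg hyx.le (-1 - β)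
  rw [abs_mul, abs_of_pos (Real.exp_pos _), abs_of_nonneg e2]
  exact mul_le_of_le_one_left e2 e1

theorem integrableOn_Iio_kernel (hβ : 0 < β) (hlam : 0 ≤ lam) (hx : a < x) :
    IntegrableOn (fun y => Real.exp (-lam * |x - y|) * |x - y| ^ (-1 - β)) (Iio a) := by
  have h := integrableOn_Ioi_kernel (b := -a) (x := -x) hβ hlam (by linarith)
  have := (Measure.measurePreserving_neg (volume : Measure ℝ)).integrableOn_comp_preimage
      (Homeomorph.neg ℝ).measurableEmbedding
      (f := fun y => Real.exp (-lam * |-x - y|) * |-x - y| ^ (-1 - β)) (s := Ioi (-a))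
  have h1 := this.2 h
  have e : ∀ y : ℝ, |-x + y| = |x - y| := fun y => by rw [← abs_neg]; congr 1; ring
  simpa [Function.comp_def, e] using h1

theorem integrableOn_mul_kernel {s : Set ℝ} (hg : Measurable g) (hs : s ⊆ (Ioo a b)ᶜ)
    (hgint : IntegrableOn (fun y => |g y| * Real.exp (-lam * |x - y|) * |x - y| ^ (-1 - β))
        (Ioo a b)ᶜ) :
    IntegrableOn (fun y => g y * (Real.exp (-lam * |x - y|) * |x - y| ^ (-1 - β))) s := by
  refine Integrable.mono (hgint.mono_set hs) (by fun_prop) (Filter.Eventually.of_forall fun y => ?_)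
  simp [mul_assoc]

/-- The exterior part of the operator. -/
theorem exterior_integral {s : Set ℝ} (hms : MeasurableSet s) (hg : Measurable g)
    (hs : s ⊆ (Ioo a b)ᶜ) (hug : ∀ x, x ∉ Ioo a b → u x = g x)
    (hk : IntegrableOn (fun y => Real.exp (-lam * |x - y|) * |x - y| ^ (-1 - β)) s)
    (hgint : IntegrableOn (fun y => |g y| * Real.exp (-lam * |x - y|) * |x - y| ^ (-1 - β))
        (Ioo a b)ᶜ) :
    IntegrableOn (fun y => (u x - u y) * Real.exp (-lam * |x - y|) * |x - y| ^ (-1 - β)) s ∧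
    ∫ y in s, (u x - u y) * Real.exp (-lam * |x - y|) * |x - y| ^ (-1 - β)
      = u x * (∫ y in s, Real.exp (-lam * |x - y|) * |x - y| ^ (-1 - β))
        - ∫ y in s, g y * (Real.exp (-lam * |x - y|) * |x - y| ^ (-1 - β)) := by
  have i2 := integrableOn_mul_kernel hg hs hgint
  have heq : EqOn (fun y => (u x - u y) * Real.exp (-lam * |x - y|) * |x - y| ^ (-1 - β))
      (fun y => u x * (Real.exp (-lam * |x - y|) * |x - y| ^ (-1 - β))
        - g y * (Real.exp (-lam * |x - y|) * |x - y| ^ (-1 - β))) s := by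
    intro y hy
    simp only [hug y (hs hy)]
    ring
  refine ⟨IntegrableOn.congr_fun (Integrable.sub (hk.const_mul (u x)) i2) heq.symm hms, ?_⟩
  rw [setIntegral_congr_fun hms heq, integral_sub (hk.const_mul (u x)) i2, integral_const_mul]

theorem truncated_integral_eq (hβ : β ∈ Ioo (1 : ℝ) 2) (hlam : 0 ≤ lam)
    (hu : ContinuousOn u (Icc a b)) (hg : Measurable g)
    (hug : ∀ x, x ∉ Ioo a b → u x = g x) (hx : x ∈ Ioo a b)
    (hgint : IntegrableOn (fun y => |g y| * Real.exp (-lam * |x - y|) * |x - y| ^ (-1 - β))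
        (Ioo a b)ᶜ)
    {ε : ℝ} (hε : 0 < ε) (hεa : ε ≤ x - a) (hεb : ε ≤ b - x) :
    ∫ y in {y : ℝ | ε < |x - y|}, (u x - u y) * Real.exp (-lam * |x - y|) * |x - y| ^ (-1 - β)
      = u x * ((∫ y in Iio a, Real.exp (-lam * |x - y|) * |x - y| ^ (-1 - β))
            + ∫ y in Ioi b, Real.exp (-lam * |x - y|) * |x - y| ^ (-1 - β))
        - (∫ y in Iio a, g y * (Real.exp (-lam * |x - y|) * |x - y| ^ (-1 - β)))
        - (∫ y in Ioi b, g y * (Real.exp (-lam * |x - y|) * |x - y| ^ (-1 - β)))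
        + (∫ t in ε..(x - a), (u x - u (x + (-1) * t)) * Real.exp (-lam * t) * t ^ (-1 - β))
        + ∫ t in ε..(b - x), (u x - u (x + 1 * t)) * Real.exp (-lam * t) * t ^ (-1 - β) := by
  set G : ℝ → ℝ := fun y => (u x - u y) * Real.exp (-lam * |x - y|) * |x - y| ^ (-1 - β) with hG
  have hβ0 : 0 < β := by linarith [hβ.1]
  obtain ⟨il, el⟩ := exterior_integral (s := Iio a) measurableSet_Iio hg
    (fun y hy h => absurd h.1 (not_lt.2 (mem_Iio.1 hy).le)) hug
    (integrableOn_Iio_kernel hβ0 hlam hx.1) hgint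
  obtain ⟨ir, er⟩ := exterior_integral (s := Ioi b) measurableSet_Ioi hg
    (fun y hy h => absurd h.2 (not_lt.2 (mem_Ioi.1 hy).le)) hug
    (integrableOn_Ioi_kernel hβ0 hlam hx.2) hgint
  have hcont : ∀ s ⊆ Icc a b, x ∉ s → ContinuousOn G s := by
    intro s hs hxs
    refine ContinuousOn.mul (ContinuousOn.mul (continuousOn_const.sub (hu.mono hs))
      (by fun_prop)) ?_
    refine ContinuousOn.rpow_const (by fun_prop) fun y hy => Or.inl ?_
    rw [abs_ne_zero, sub_ne_zero]
    rintro rfl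
    exact hxs hy
  have iml : IntegrableOn G (Icc a (x - ε)) :=
    (hcont _ (Icc_subset_Icc_right (by linarith [hx.2])) (fun h => by linarith [h.2])
      ).integrableOn_Icc
  have imr : IntegrableOn G (Icc (x + ε) b) :=
    (hcont _ (Icc_subset_Icc_left (by linarith [hx.1])) (fun h => by linarith [h.1])
      ).integrableOn_Icc
  have iml' : IntegrableOn G (Ico a (x - ε)) := iml.mono_set Ico_subset_Icc_self
  have imr' : IntegrableOn G (Ioc (x + ε) b) := imr.mono_set Ioc_subset_Icc_self
  have hS : {y : ℝ | ε < |x - y|} = (Iio a ∪ Ico a (x - ε)) ∪ (Ioc (x + ε) b ∪ Ioi b) := by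
    rw [Iio_union_Ico_eq_Iio (by linarith), Ioc_union_Ioi_eq_Ioi (by linarith)]
    ext y
    simp only [mem_ofPred_eq, mem_union, mem_Iio, mem_Ioi, lt_abs]
    constructor <;> rintro (h | h)
    · left; linarith
    · right; linarith
    · left; linarith
    · right; linarith
  have hd : Disjoint (Iio a ∪ Ico a (x - ε)) (Ioc (x + ε) b ∪ Ioi b) := by
    rw [Iio_union_Ico_eq_Iio (by linarith), Ioc_union_Ioi_eq_Ioi (by linarith)]
    exact Set.disjoint_left.2 fun y hy hy' => by
      have := mem_Iio.1 hy
      have := mem_Ioi.1 hy'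
      linarith
  have hdl : Disjoint (Iio a) (Ico a (x - ε)) :=
    Set.disjoint_left.2 fun y hy hy' => absurd hy'.1 (not_le.2 hy)
  have hdr : Disjoint (Ioc (x + ε) b) (Ioi b) :=
    Set.disjoint_left.2 fun y hy hy' => absurd hy.2 (not_le.2 hy')
  rw [hS, setIntegral_union hd (measurableSet_Ioc.union measurableSet_Ioi)
      (il.union iml') (imr'.union ir),
    setIntegral_union hdl measurableSet_Ico il iml',
    setIntegral_union hdr measurableSet_Ioi imr' ir, el, er]
  have hleft : ∫ y in Ico a (x - ε), G y
      = ∫ t in ε..(x - a), (u x - u (x + (-1) * t)) * Real.exp (-lam * t) * t ^ (-1 - β) := by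
    rw [integral_Ico_eq_integral_Ioc, ← intervalIntegral.integral_of_le (by linarith)]
    have := intervalIntegral.integral_comp_sub_left (a := a) (b := x - ε)
      (fun t => (u x - u (x + (-1) * t)) * Real.exp (-lam * t) * t ^ (-1 - β)) x
    rw [sub_sub_cancel] at this
    rw [← this]
    refine intervalIntegral.integral_congr fun y hy => ?_
    rw [uIcc_of_le (by linarith)] at hy
    have hxy : 0 ≤ x - y := by linarith [hy.2]
    simp only [hG, abs_of_nonneg hxy]
    rw [show x + -1 * (x - y) = y by ring]
  have hright : ∫ y in Ioc (x + ε) b, G y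
      = ∫ t in ε..(b - x), (u x - u (x + 1 * t)) * Real.exp (-lam * t) * t ^ (-1 - β) := by
    rw [← intervalIntegral.integral_of_le (by linarith)]
    have := intervalIntegral.integral_comp_sub_right (a := x + ε) (b := b)
      (fun t => (u x - u (x + 1 * t)) * Real.exp (-lam * t) * t ^ (-1 - β)) x
    rw [add_sub_cancel_left] at this
    rw [← this]
    refine intervalIntegral.integral_congr fun y hy => ?_
    rw [uIcc_of_le (by linarith)] at hy
    have hxy : 0 ≤ y - x := by linarith [hy.1]
    simp only [hG, abs_sub_comm x y, abs_of_nonneg hxy]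
    rw [show x + 1 * (y - x) = y by ring]
  rw [hleft, hright]
  ring

theorem consistency_error_le {f : ℝ → ℝ} {u₁ u₂ u₃ : ℝ → ℝ} {K h : ℝ}
    (hβ : β ∈ Ioo (1 : ℝ) 2) (hlam : 0 ≤ lam) (hK : 0 ≤ K)
    (hu : ContinuousOn u (Icc a b)) (hc : ContinuousOn u₁ (Icc a b))
    (h1 : ∀ x ∈ Ioo a b, HasDerivAt u (u₁ x) x)
    (h2 : ∀ x ∈ Ioo a b, HasDerivAt u₁ (u₂ x) x)
    (h3 : ∀ x ∈ Ioo a b, HasDerivAt u₂ (u₃ x) x)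
    (hK1 : ∀ x ∈ Icc a b, |u₁ x| ≤ K) (hK2 : ∀ x ∈ Icc a b, |u₂ x| ≤ K)
    (hK3 : ∀ x ∈ Icc a b, |u₃ x| ≤ K) (hg : Measurable g)
    (hug : ∀ x, x ∉ Ioo a b → u x = g x)
    (hgint : IntegrableOn (fun y => |g y| * Real.exp (-lam * |x - y|) * |x - y| ^ (-1 - β))
        (Ioo a b)ᶜ)
    (hf : Filter.Tendsto
        (fun ε : ℝ => ∫ y in {y : ℝ | ε < |x - y|},
          (u x - u y) * Real.exp (-lam * |x - y|) * |x - y| ^ (-1 - β))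
        (nhdsWithin 0 (Ioi 0)) (nhds (f x)))
    (hh : 0 < h) (m n : ℕ) (hxa : x - a = (m + 1) * h) (hxb : b - x = (n + 1) * h) :
    |f x - (u x * ((∫ y in Iio a, Real.exp (-lam * |x - y|) * |x - y| ^ (-1 - β))
            + ∫ y in Ioi b, Real.exp (-lam * |x - y|) * |x - y| ^ (-1 - β))
          - (∫ y in Iio a, g y * (Real.exp (-lam * |x - y|) * |x - y| ^ (-1 - β)))
          - ∫ y in Ioi b, g y * (Real.exp (-lam * |x - y|) * |x - y| ^ (-1 - β)))
        - (∑ j ∈ Finset.range m, nodeCoeff β lam h j * (u x - u (x + (-1) * ((j + 1) * h)))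
          + boundaryCoeff β lam h m * (u x - u (x + (-1) * ((m + 1) * h))))
        - (∑ j ∈ Finset.range n, nodeCoeff β lam h j * (u x - u (x + 1 * ((j + 1) * h)))
          + boundaryCoeff β lam h n * (u x - u (x + 1 * ((n + 1) * h))))|
      ≤ 2 * ((lam + 1) ^ 2 * K * (1 / (2 - β) + 1 / (β - 1))) * h ^ (3 - β) := by
  have hm0 : (0 : ℝ) ≤ m := m.cast_nonneg
  have hn0 : (0 : ℝ) ≤ n := n.cast_nonneg
  have hma : h ≤ x - a := by rw [hxa]; nlinarith
  have hnb : h ≤ b - x := by rw [hxb]; nlinarith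
  have hx : x ∈ Ioo a b := ⟨by linarith, by linarith⟩
  have hab : a ≤ b := (hx.1.trans hx.2).le
  have hLa : x + (-1) * ((m + 1) * h) ∈ Icc a b := by
    rw [← hxa, show x + (-1) * (x - a) = a by ring]; exact left_mem_Icc.2 hab
  have hLb : x + 1 * ((n + 1) * h) ∈ Icc a b := by
    rw [← hxb, show x + 1 * (b - x) = b by ring]; exact right_mem_Icc.2 hab
  set E : ℝ := u x * ((∫ y in Iio a, Real.exp (-lam * |x - y|) * |x - y| ^ (-1 - β))
            + ∫ y in Ioi b, Real.exp (-lam * |x - y|) * |x - y| ^ (-1 - β))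
          - (∫ y in Iio a, g y * (Real.exp (-lam * |x - y|) * |x - y| ^ (-1 - β)))
          - ∫ y in Ioi b, g y * (Real.exp (-lam * |x - y|) * |x - y| ^ (-1 - β)) with hE
  set SL : ℝ := ∑ j ∈ Finset.range m,
      nodeCoeff β lam h j * (u x - u (x + (-1) * ((j + 1) * h)))
    + boundaryCoeff β lam h m * (u x - u (x + (-1) * ((m + 1) * h))) with hSL
  set SR : ℝ := ∑ j ∈ Finset.range n, nodeCoeff β lam h j * (u x - u (x + 1 * ((j + 1) * h)))
    + boundaryCoeff β lam h n * (u x - u (x + 1 * ((n + 1) * h))) with hSR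
  set C : ℝ := (lam + 1) ^ 2 * K * (1 / (2 - β) + 1 / (β - 1)) with hC
  have hlim := (((hf.sub_const E).sub_const SL).sub_const SR).abs
  have hzero : Filter.Tendsto (fun ε : ℝ => 2 * C * h ^ (3 - β)
      + 2 * (K * (ε ^ (2 - β) / ((2 - β) * h)))) (nhdsWithin 0 (Ioi 0))
      (nhds (2 * C * h ^ (3 - β))) := by
    have h0 : 0 < 2 - β := by linarith [hβ.2]
    have h4 : Filter.Tendsto (fun ε : ℝ => ε ^ (2 - β)) (nhdsWithin 0 (Ioi 0)) (nhds 0) := by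
      have := (Real.continuousAt_rpow_const 0 (2 - β) (Or.inr h0.le)).tendsto
      rw [Real.zero_rpow h0.ne'] at this
      exact this.mono_left nhdsWithin_le_nhds
    simpa using (((h4.div_const ((2 - β) * h)).const_mul K).const_mul 2).const_add
      (2 * C * h ^ (3 - β))
  refine le_of_tendsto_of_tendsto hlim hzero ?_
  filter_upwards [Ioo_mem_nhdsGT hh] with ε hε
  have oL := one_sided_error_le (h := h) hβ hlam hK (σ := -1) (by simp) hu hc h1 h2 h3 hK1 hK2 hK3
    hx m hLa hε.1 hε.2.le
  have oR := one_sided_error_le (h := h) hβ hlam hK (σ := 1) (by simp) hu hc h1 h2 h3 hK1 hK2 hK3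
    hx n hLb hε.1 hε.2.le
  rw [← hxa, hxa, ← hSL, ← hC] at oL
  rw [← hSR, ← hC] at oR
  rw [truncated_integral_eq hβ hlam hu hg hug hx hgint hε.1 (hε.2.le.trans hma)
    (hε.2.le.trans hnb), ← hE, hxa, hxb]
  rw [abs_le] at oL oR ⊢
  constructor <;> linarith [oL.1, oL.2, oR.1, oR.2]

end Consistency

end

noncomputable section

section Scheme

variable {a b β lam : ℝ} {M : ℕ}

theorem gH_pos (hab : a < b) (M : ℕ) : 0 < gH a b M :=
  div_pos (by linarith) (by positivity)

theorem gH_mul (M : ℕ) : ((M : ℝ) + 1) * gH a b M = b - a := by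
  unfold gH
  field_simp

theorem rpow_neg_cast_one_sub_one {h : ℝ} (hh : 0 < h) :
    h ^ (-((1 : ℕ) : ℝ) - 1) = (h ^ 2)⁻¹ := by
  rw [show -((1 : ℕ) : ℝ) - 1 = -2 by norm_num, Real.rpow_neg hh.le, Real.rpow_two]

theorem cA1_eq (hab : a < b) (k d : ℕ) :
    cA1 a b β 1 M (k + 1 + d) (k + 1) = rightWeight β (gH a b M) d := by
  unfold cA1 rightWeight
  rw [rpow_neg_cast_one_sub_one (gH_pos hab M), Nat.add_sub_cancel]
  congr 1
  have := intervalIntegral.integral_comp_sub_left (a := gX a b M k) (b := gX a b M (k + 1))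
    (fun t => (t - d * gH a b M) * t ^ (-β)) (gX a b M (k + 1 + d))
  have e1 : gX a b M (k + 1 + d) - gX a b M (k + 1) = d * gH a b M := by
    simp only [gX]; push_cast; ring
  have e2 : gX a b M (k + 1 + d) - gX a b M k = (d + 1) * gH a b M := by
    simp only [gX]; push_cast; ring
  rw [e1, e2] at this
  rw [← this, ← e1]
  congr 1
  ext y
  rw [show ((1 : ℕ) : ℝ) - 1 - β = -β by norm_num]
  ring

theorem cA2_eq (hab : a < b) (k d : ℕ) :
    cA2 a b β 1 M (k + 1 + d) (k + 1) = leftWeight β (gH a b M) d := by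
  unfold cA2 leftWeight
  rw [rpow_neg_cast_one_sub_one (gH_pos hab M), Nat.add_sub_cancel]
  congr 1
  have := intervalIntegral.integral_comp_sub_left (a := gX a b M k) (b := gX a b M (k + 1))
    (fun t => ((d + 1) * gH a b M - t) * t ^ (-β)) (gX a b M (k + 1 + d))
  have e1 : gX a b M (k + 1 + d) - gX a b M (k + 1) = d * gH a b M := by
    simp only [gX]; push_cast; ring
  have e2 : gX a b M (k + 1 + d) - gX a b M k = (d + 1) * gH a b M := by
    simp only [gX]; push_cast; ring
  rw [e1, e2] at this
  rw [← this, ← e2]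
  congr 1
  ext y
  rw [show ((1 : ℕ) : ℝ) - 1 - β = -β by norm_num]
  ring

theorem cA3_eq (hab : a < b) (i d : ℕ) :
    cA3 a b β 1 M i (i + d + 1) = leftWeight β (gH a b M) d := by
  unfold cA3 leftWeight
  rw [rpow_neg_cast_one_sub_one (gH_pos hab M), Nat.add_sub_cancel]
  congr 1
  have := intervalIntegral.integral_comp_sub_right (a := gX a b M (i + d))
    (b := gX a b M (i + d + 1))
    (fun t => ((d + 1) * gH a b M - t) * t ^ (-β)) (gX a b M i)
  have e1 : gX a b M (i + d) - gX a b M i = d * gH a b M := by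
    simp only [gX]; push_cast; ring
  have e2 : gX a b M (i + d + 1) - gX a b M i = (d + 1) * gH a b M := by
    simp only [gX]; push_cast; ring
  rw [e1, e2] at this
  rw [← this, ← e2]
  congr 1
  ext y
  rw [show ((1 : ℕ) : ℝ) - 1 - β = -β by norm_num]
  ring

theorem cA4_eq (hab : a < b) (i d : ℕ) :
    cA4 a b β 1 M i (i + d + 1) = rightWeight β (gH a b M) d := by
  unfold cA4 rightWeight
  rw [rpow_neg_cast_one_sub_one (gH_pos hab M), Nat.add_sub_cancel]
  congr 1
  have := intervalIntegral.integral_comp_sub_right (a := gX a b M (i + d))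
    (b := gX a b M (i + d + 1))
    (fun t => (t - d * gH a b M) * t ^ (-β)) (gX a b M i)
  have e1 : gX a b M (i + d) - gX a b M i = d * gH a b M := by
    simp only [gX]; push_cast; ring
  have e2 : gX a b M (i + d + 1) - gX a b M i = (d + 1) * gH a b M := by
    simp only [gX]; push_cast; ring
  rw [e1, e2] at this
  rw [← this, ← e1]
  congr 1
  ext y
  rw [show ((1 : ℕ) : ℝ) - 1 - β = -β by norm_num]
  ring

theorem rightWeight_zero_mul (hβ : β ∈ Ioo (1 : ℝ) 2) {h : ℝ} (hh : 0 < h) (r : ℝ) :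
    h ^ (-β) * r / (((1 : ℕ) : ℝ) + 1 - β) = rightWeight β h 0 * r := by
  rw [rightWeight_zero hβ hh, show 2 - β = 2 + -β by ring, Real.rpow_add hh, Real.rpow_two]
  have : 2 + -β ≠ 0 := by linarith [hβ.2]
  rw [show ((1 : ℕ) : ℝ) + 1 - β = 2 + -β by push_cast; ring]
  field_simp

theorem nodeCoeff_nonneg {h : ℝ} (hh : 0 ≤ h) (j : ℕ) : 0 ≤ nodeCoeff β lam h j :=
  mul_nonneg (add_nonneg (rightWeight_nonneg hh _) (leftWeight_nonneg hh _))
    (div_nonneg (Real.exp_pos _).le (by positivity))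

theorem boundaryCoeff_nonneg {h : ℝ} (hh : 0 ≤ h) (j : ℕ) : 0 ≤ boundaryCoeff β lam h j :=
  mul_nonneg (rightWeight_nonneg hh _) (div_nonneg (Real.exp_pos _).le (by positivity))

theorem offD_left (hab : a < b) (hβ : β ∈ Ioo (1 : ℝ) 2) (p j : ℕ) :
    offD a b β lam 1 1 M (p + j + 2) (p + 1) = -nodeCoeff β lam (gH a b M) j := by
  unfold offD nodeCoeff
  rcases j with _ | j
  · rw [if_neg (by omega), if_pos (by omega), rightWeight_zero_mul hβ (gH_pos hab M)]
    have := cA2_eq (β := β) (M := M) hab p 1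
    rw [show p + 1 + 1 = p + 0 + 2 by ring] at this
    rw [show p + 0 + 2 - 1 = p + 1 by omega, this]
    push_cast
    ring_nf
  · rw [if_pos (by omega)]
    have h1 := cA1_eq (β := β) (M := M) hab (p + 1) (j + 1)
    have h2 := cA2_eq (β := β) (M := M) hab p (j + 1 + 1)
    rw [show p + 1 + 1 + (j + 1) = p + (j + 1) + 2 by ring] at h1
    rw [show p + 1 + (j + 1 + 1) = p + (j + 1) + 2 by ring] at h2
    have e : ((p + (j + 1) + 2 : ℕ) : ℝ) - (p + 1 : ℕ) = (j + 1 : ℕ) + 1 := by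
      push_cast; ring
    rw [h1, h2, e, Nat.cast_one, Real.rpow_neg_one, mul_assoc, mul_assoc, div_eq_mul_inv]

theorem offD_right (hab : a < b) (hβ : β ∈ Ioo (1 : ℝ) 2) (i j : ℕ) :
    offD a b β lam 1 1 M i (i + j + 1) = -nodeCoeff β lam (gH a b M) j := by
  unfold offD nodeCoeff
  rcases j with _ | j
  · rw [if_neg (by omega), if_neg (by omega), if_pos (by omega),
      rightWeight_zero_mul hβ (gH_pos hab M)]
    have := cA3_eq (β := β) (M := M) hab i 1
    rw [show i + 1 + 1 = i + 2 by ring] at this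
    rw [this]
    push_cast
    ring_nf
  · rw [if_neg (by omega), if_neg (by omega), if_neg (by omega), if_pos (by omega)]
    have h1 := cA3_eq (β := β) (M := M) hab i (j + 1 + 1)
    have h2 := cA4_eq (β := β) (M := M) hab i (j + 1)
    have e : ((i + (j + 1) + 1 : ℕ) : ℝ) - i = (j + 1 : ℕ) + 1 := by
      push_cast; ring
    rw [show i + (j + 1 + 1) + 1 = i + (j + 1) + 1 + 1 by ring] at h1
    rw [h1, h2, e, Nat.cast_one, Real.rpow_neg_one, mul_assoc, mul_assoc, div_eq_mul_inv, add_comm]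

theorem offD_nonpos (hab : a < b) (hβ : β ∈ Ioo (1 : ℝ) 2) {i j : ℕ} :
    offD a b β lam 1 1 M (i + 1) (j + 1) ≤ 0 := by
  have hn := fun k => nodeCoeff_nonneg (β := β) (lam := lam) (gH_pos hab M).le k
  rcases lt_trichotomy i j with h | h | h
  · obtain ⟨k, rfl⟩ := Nat.exists_eq_add_of_lt h
    rw [show i + k + 1 + 1 = i + 1 + k + 1 by ring, offD_right hab hβ]
    linarith [hn k]
  · subst h
    simp [offD]
  · obtain ⟨k, rfl⟩ := Nat.exists_eq_add_of_lt h
    rw [show j + k + 1 + 1 = j + k + 2 by ring, offD_left hab hβ]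
    linarith [hn k]

theorem boundary_left (hab : a < b) (m : ℕ) :
    cA1 a b β 1 M (m + 1) 1 * Real.exp (-lam * ((m : ℝ) + 1) * gH a b M)
      * ((m : ℝ) + 1) ^ (-((1 : ℕ) : ℝ)) = boundaryCoeff β lam (gH a b M) m := by
  have h1 := cA1_eq (β := β) (M := M) hab 0 m
  rw [show 0 + 1 + m = m + 1 by ring, zero_add] at h1
  rw [h1, boundaryCoeff, Nat.cast_one, Real.rpow_neg_one, mul_assoc, mul_assoc, div_eq_mul_inv]

theorem boundary_right (hab : a < b) (m n : ℕ) :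
    cA4 a b β 1 M (m + 1) (m + n + 1 + 1) * Real.exp (-lam * ((n : ℝ) + 1) * gH a b M)
      * ((n : ℝ) + 1) ^ (-((1 : ℕ) : ℝ)) = boundaryCoeff β lam (gH a b M) n := by
  have h1 := cA4_eq (β := β) (M := M) hab (m + 1) n
  rw [show m + 1 + n + 1 = m + n + 1 + 1 by ring] at h1
  rw [h1, boundaryCoeff, Nat.cast_one, Real.rpow_neg_one, mul_assoc, mul_assoc, div_eq_mul_inv]

theorem boundary_adjacent (hab : a < b) (hβ : β ∈ Ioo (1 : ℝ) 2) :
    gH a b M ^ (-β) * Real.exp (-lam * gH a b M) / (((1 : ℕ) : ℝ) + 1 - β)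
      = boundaryCoeff β lam (gH a b M) 0 := by
  rw [rightWeight_zero_mul hβ (gH_pos hab M), boundaryCoeff]
  simp

theorem diagExtra_eq (hab : a < b) (hβ : β ∈ Ioo (1 : ℝ) 2) {m n : ℕ} (hM : M = m + n + 1)
    (h3 : 3 ≤ M) :
    diagExtra a b β lam 1 1 M (m + 1)
      = boundaryCoeff β lam (gH a b M) m + boundaryCoeff β lam (gH a b M) n := by
  have hl := boundary_left (β := β) (lam := lam) (M := M) hab m
  have hr := boundary_right (β := β) (lam := lam) (M := M) hab m n
  have ha := boundary_adjacent (lam := lam) (M := M) hab hβ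
  rw [← hM] at hr
  have hMr : (M : ℝ) = m + n + 1 := by rw [hM]; push_cast; ring
  unfold diagExtra
  split_ifs with h1 h2
  · have hm : m = 0 := by omega
    subst hm
    have e : (M : ℝ) = n + 1 := by rw [hMr]; simp
    rw [ha, e, ← hr]
  · have hn : n = 0 := by omega
    subst hn
    have e : (M : ℝ) = m + 1 := by rw [hMr]; simp
    rw [ha, e, ← hl, add_comm, ← h2]
  · rw [← hl, ← hr, show (M : ℝ) + 1 - (m + 1 : ℕ) = n + 1 by rw [hMr]; push_cast; ring]
    push_cast
    rfl

theorem loadF_eq (hab : a < b) (hβ : β ∈ Ioo (1 : ℝ) 2) (f g u : ℝ → ℝ) (i : Fin M) {n : ℕ}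
    (hM : M = i.val + n + 1) :
    loadF a b β lam 1 1 f g u M i
      = f (gX a b M (i.val + 1)) + dd1 a b β lam g M (i.val + 1) + dd2 a b β lam g M (i.val + 1)
        + boundaryCoeff β lam (gH a b M) i.val * u a
        + boundaryCoeff β lam (gH a b M) n * u b := by
  have hl := boundary_left (β := β) (lam := lam) (M := M) hab i.val
  have hr := boundary_right (β := β) (lam := lam) (M := M) hab i.val n
  have ha := boundary_adjacent (lam := lam) (M := M) hab hβ
  rw [← hM] at hr
  have hMr : (M : ℝ) - (i.val : ℝ) = n + 1 := by
    rw [sub_eq_iff_eq_add]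
    have : (M : ℝ) = ((i.val + n + 1 : ℕ) : ℝ) := by rw [← hM]
    rw [this]; push_cast; ring
  unfold loadF
  rw [hl, ha, hMr, hr]
  congr 2
  · congr 2
    split_ifs with h
    · rw [show i.val = 0 by omega]
    · rfl
  · split_ifs with h
    · rw [show n = 0 by omega]
    · rfl

theorem stiff_mulVec (v : Fin M → ℝ) (i : Fin M) :
    (stiff a b β lam 1 1 M).mulVec v i
      = (cB1 a b β lam M (i.val + 1) + cB2 a b β lam M (i.val + 1)
          + diagExtra a b β lam 1 1 M (i.val + 1)) * v i
        + ∑ j, offD a b β lam 1 1 M (i.val + 1) (j.val + 1) * (v j - v i) := by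
  simp only [Matrix.mulVec, dotProduct]
  rw [← Finset.add_sum_erase _ _ (Finset.mem_univ i),
    ← Finset.add_sum_erase _ (fun j => offD a b β lam 1 1 M (i.val + 1) (j.val + 1) * (v j - v i))
      (Finset.mem_univ i)]
  have h1 : ∑ j ∈ Finset.univ.erase i, stiff a b β lam 1 1 M i j * v j
      = ∑ j ∈ Finset.univ.erase i, offD a b β lam 1 1 M (i.val + 1) (j.val + 1) * v j := by
    refine Finset.sum_congr rfl fun j hj => ?_
    rw [stiff, if_neg (Finset.ne_of_mem_erase hj).symm]
  rw [h1]
  simp only [mul_sub, Finset.sum_sub_distrib, ← Finset.sum_mul]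
  rw [stiff, if_pos rfl]
  ring

/-- Sum over the grid, split according to the distance to the `i`-th node. -/
theorem sum_offD_mul (hab : a < b) (hβ : β ∈ Ioo (1 : ℝ) 2) (w : ℕ → ℝ) (i : Fin M) {n : ℕ}
    (hM : M = i.val + n + 1) :
    ∑ j : Fin M, offD a b β lam 1 1 M (i.val + 1) (j.val + 1) * (w (j.val + 1) - w (i.val + 1))
      = ∑ j ∈ Finset.range i.val,
          nodeCoeff β lam (gH a b M) j * (w (i.val + 1) - w (i.val - j))
        + ∑ j ∈ Finset.range n,
          nodeCoeff β lam (gH a b M) j * (w (i.val + 1) - w (i.val + 1 + j + 1)) := by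
  set m := i.val with hm
  rw [Fin.sum_univ_eq_sum_range
    (fun j => offD a b β lam 1 1 M (m + 1) (j + 1) * (w (j + 1) - w (m + 1))) M]
  have : Finset.range M = Finset.range (m + 1 + n) := by rw [hM]; congr 1; ring
  rw [this, Finset.sum_range_add, Finset.sum_range_succ, sub_self, mul_zero, add_zero]
  congr 1
  · rw [← Finset.sum_range_reflect]
    refine Finset.sum_congr rfl fun j hj => ?_
    have hj' := Finset.mem_range.1 hj
    obtain ⟨p, hp⟩ := Nat.exists_eq_add_of_lt hj'
    rw [show m - 1 - j + 1 = p + 1 by omega, show m + 1 = p + j + 2 by omega,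
      offD_left hab hβ, show m - j = p + 1 by omega]
    ring
  · refine Finset.sum_congr rfl fun j _ => ?_
    rw [offD_right hab hβ]
    ring

theorem cB1_eq (i : ℕ) (hi : a < gX a b M i) :
    cB1 a b β lam M i = ∫ y in Iio a,
      Real.exp (-lam * |gX a b M i - y|) * |gX a b M i - y| ^ (-1 - β) := by
  refine setIntegral_congr_fun measurableSet_Iio fun y hy => ?_
  have : 0 < gX a b M i - y := by have := mem_Iio.1 hy; linarith
  simp only [abs_of_pos this]
  ring_nf

theorem cB2_eq (i : ℕ) (hi : gX a b M i < b) :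
    cB2 a b β lam M i = ∫ y in Ioi b,
      Real.exp (-lam * |gX a b M i - y|) * |gX a b M i - y| ^ (-1 - β) := by
  refine setIntegral_congr_fun measurableSet_Ioi fun y hy => ?_
  have : 0 < y - gX a b M i := by have := mem_Ioi.1 hy; linarith
  simp only [abs_sub_comm (gX a b M i) y, abs_of_pos this]
  ring_nf

theorem dd1_eq (g : ℝ → ℝ) (i : ℕ) (hi : a < gX a b M i) :
    dd1 a b β lam g M i = ∫ y in Iio a,
      g y * (Real.exp (-lam * |gX a b M i - y|) * |gX a b M i - y| ^ (-1 - β)) := by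
  refine setIntegral_congr_fun measurableSet_Iio fun y hy => ?_
  have : 0 < gX a b M i - y := by have := mem_Iio.1 hy; linarith
  simp only [abs_of_pos this]
  ring

theorem dd2_eq (g : ℝ → ℝ) (i : ℕ) (hi : gX a b M i < b) :
    dd2 a b β lam g M i = ∫ y in Ioi b,
      g y * (Real.exp (-lam * |gX a b M i - y|) * |gX a b M i - y| ^ (-1 - β)) := by
  refine setIntegral_congr_fun measurableSet_Ioi fun y hy => ?_
  have : 0 < y - gX a b M i := by have := mem_Ioi.1 hy; linarith
  simp only [abs_sub_comm (gX a b M i) y, abs_of_pos this]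
  ring

theorem cB1_nonneg (i : ℕ) (hi : a < gX a b M i) : 0 ≤ cB1 a b β lam M i := by
  rw [cB1_eq i hi]
  exact integral_nonneg fun y => mul_nonneg (Real.exp_pos _).le (Real.rpow_nonneg (abs_nonneg _) _)

/-- The mass of the kernel to the right of `b`, seen from `a`. -/
def tailMass (a b β lam : ℝ) : ℝ :=
  ∫ y in Ioi b, Real.exp (-lam * |a - y|) * |a - y| ^ (-1 - β)

theorem tailMass_pos (hab : a < b) (hβ : 0 < β) (hlam : 0 ≤ lam) : 0 < tailMass a b β lam := by
  have h0 : ∀ y, 0 ≤ Real.exp (-lam * |a - y|) * |a - y| ^ (-1 - β) :=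
    fun y => mul_nonneg (Real.exp_pos _).le (Real.rpow_nonneg (abs_nonneg _) _)
  refine (setIntegral_pos_iff_support_of_nonneg_ae (Filter.Eventually.of_forall h0)
    (integrableOn_Ioi_kernel hβ hlam hab)).2 ?_
  have : Ioi b ⊆ Function.support (fun y => Real.exp (-lam * |a - y|) * |a - y| ^ (-1 - β)) := by
    intro y hy
    have : a - y ≠ 0 := by have := mem_Ioi.1 hy; linarith
    exact (mul_pos (Real.exp_pos _) (Real.rpow_pos_of_pos (abs_pos.2 this) _)).ne'
  rw [inter_eq_right.2 this]
  simp

theorem tailMass_le_cB2 (hβ : 0 < β) (hlam : 0 ≤ lam) (i : ℕ)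
    (hi : gX a b M i ∈ Ioo a b) : tailMass a b β lam ≤ cB2 a b β lam M i := by
  rw [cB2_eq i hi.2]
  refine setIntegral_mono_on (integrableOn_Ioi_kernel hβ hlam (hi.1.trans hi.2))
    (integrableOn_Ioi_kernel hβ hlam hi.2) measurableSet_Ioi fun y hy => ?_
  have hy := mem_Ioi.1 hy
  have h1 := hi.1
  have h2 := hi.2
  have p1 : 0 < y - gX a b M i := by linarith
  have p2 : 0 < y - a := by linarith
  rw [abs_sub_comm, abs_sub_comm (gX a b M i), abs_of_pos p1, abs_of_pos p2]
  refine mul_le_mul (Real.exp_le_exp.2 (by nlinarith)) ?_ (Real.rpow_nonneg p2.le _)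
    (Real.exp_pos _).le
  exact Real.rpow_le_rpow_of_nonpos p1 (by linarith) (by linarith)

theorem gX_mem_Ioo (hab : a < b) (i : Fin M) : gX a b M (i.val + 1) ∈ Ioo a b := by
  have hh := gH_pos hab M
  have hb := gH_mul (a := a) (b := b) M
  have hi : (i.val : ℝ) + 1 ≤ M := by exact_mod_cast i.isLt
  have hi0 : (0 : ℝ) ≤ i.val := Nat.cast_nonneg _
  unfold gX
  push_cast
  constructor <;> nlinarith

/-- A discrete maximum principle. -/
theorem le_div_of_discrete_operator_le {ι : Type*} [Fintype ι] {D : ι → ℝ} {N : ι → ι → ℝ}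
    {c ρ : ℝ} (hc : 0 < c) (hρ : 0 ≤ ρ) (hD : ∀ i, c ≤ D i) (hN : ∀ i j, N i j ≤ 0) {e : ι → ℝ}
    (he : ∀ i, D i * e i + ∑ j, N i j * (e j - e i) ≤ ρ) (i : ι) : e i ≤ ρ / c := by
  have : Nonempty ι := ⟨i⟩
  obtain ⟨k, hk⟩ := Finite.exists_max e
  refine (hk i).trans ?_
  rcases le_total (e k) 0 with h | h
  · exact h.trans (by positivity)
  rw [le_div_iff₀ hc]
  have h1 : 0 ≤ ∑ j, N k j * (e j - e k) :=
    Finset.sum_nonneg fun j _ => mul_nonneg_of_nonpos_of_nonpos (hN k j) (by linarith [hk j])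
  nlinarith [he k, hD k]

theorem abs_le_of_stiff_mulVec (hab : a < b) (hβ : β ∈ Ioo (1 : ℝ) 2) (hlam : 0 ≤ lam)
    (h3 : 3 ≤ M) {ρ : ℝ} {e : Fin M → ℝ}
    (he : ∀ i, |(stiff a b β lam 1 1 M).mulVec e i| ≤ ρ) (i : Fin M) :
    |e i| ≤ ρ / tailMass a b β lam := by
  have hβ0 : 0 < β := by linarith [hβ.1]
  have hρ : 0 ≤ ρ := (abs_nonneg _).trans (he i)
  have hD : ∀ i : Fin M, tailMass a b β lam ≤ cB1 a b β lam M (i.val + 1)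
      + cB2 a b β lam M (i.val + 1) + diagExtra a b β lam 1 1 M (i.val + 1) := by
    intro i
    have hi := gX_mem_Ioo hab i
    rw [diagExtra_eq hab hβ (n := M - 1 - i.val) (by omega) h3]
    linarith [cB1_nonneg (β := β) (lam := lam) _ hi.1, tailMass_le_cB2 hβ0 hlam _ hi,
      boundaryCoeff_nonneg (β := β) (lam := lam) (gH_pos hab M).le i.val,
      boundaryCoeff_nonneg (β := β) (lam := lam) (gH_pos hab M).le (M - 1 - i.val)]
  have hN : ∀ i j : Fin M, offD a b β lam 1 1 M (i.val + 1) (j.val + 1) ≤ 0 :=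
    fun i j => offD_nonpos hab hβ
  have hc := tailMass_pos hab hβ0 hlam
  rw [abs_le]
  constructor
  · have := le_div_of_discrete_operator_le hc hρ hD hN (e := -e) (fun i => by
      rw [← stiff_mulVec, Matrix.mulVec_neg, Pi.neg_apply]
      linarith [(abs_le.1 (he i)).1]) i
    rw [Pi.neg_apply] at this
    linarith
  · exact le_div_of_discrete_operator_le hc hρ hD hN (fun i => by
      rw [← stiff_mulVec]
      exact (abs_le.1 (he i)).2) i

theorem isUnit_stiff (hab : a < b) (hβ : β ∈ Ioo (1 : ℝ) 2) (hlam : 0 ≤ lam) (h3 : 3 ≤ M) :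
    IsUnit (stiff a b β lam 1 1 M) := by
  rw [← Matrix.mulVec_injective_iff_isUnit]
  intro v w hvw
  ext i
  have := abs_le_of_stiff_mulVec hab hβ hlam h3 (ρ := 0) (e := v - w) (fun i => by
    rw [Matrix.mulVec_sub]
    simp [show (stiff a b β lam 1 1 M).mulVec v = (stiff a b β lam 1 1 M).mulVec w from hvw]) i
  rw [zero_div] at this
  have := abs_nonpos_iff.1 this
  rw [Pi.sub_apply] at this
  linarith

/-- Consistency of the scheme. -/
theorem exists_residual_bound (hab : a < b) (hβ : β ∈ Ioo (1 : ℝ) 2) (hlam : 0 ≤ lam)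
    {u g f : ℝ → ℝ}
    (hu : ContDiffOn ℝ 3 u (Icc a b)) (hg : Measurable g)
    (hug : ∀ x, x ∉ Ioo a b → u x = g x)
    (hgint : ∀ x ∈ Ioo a b,
      IntegrableOn (fun y => |g y| * Real.exp (-lam * |x - y|) * |x - y| ^ (-1 - β))
        (Ioo a b)ᶜ)
    (hf : ∀ x ∈ Ioo a b,
      Filter.Tendsto
        (fun ε : ℝ => ∫ y in {y : ℝ | ε < |x - y|},
          (u x - u y) * Real.exp (-lam * |x - y|) * |x - y| ^ (-1 - β))
        (nhdsWithin 0 (Ioi 0)) (nhds (f x))) :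
    ∃ C > (0 : ℝ), ∀ M : ℕ, 3 ≤ M → ∀ i : Fin M,
      |(stiff a b β lam 1 1 M).mulVec (fun i => u (gX a b M (i.val + 1))) i
        - loadF a b β lam 1 1 f g u M i| ≤ C * gH a b M ^ (3 - β) := by
  obtain ⟨u₁, u₂, u₃, K, hK, hc, h1, h2, h3, hK1, hK2, hK3⟩ := exists_bounded_derivs hab hu
  have hβ1 : 0 < β - 1 := by linarith [hβ.1]
  have hβ2 : 0 < 2 - β := by linarith [hβ.2]
  refine ⟨2 * ((lam + 1) ^ 2 * K * (1 / (2 - β) + 1 / (β - 1))), by positivity, ?_⟩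
  intro M hM3 i
  obtain ⟨n, hM⟩ := Nat.exists_eq_add_of_lt i.isLt
  have hx := gX_mem_Ioo hab i
  have hMr : (M : ℝ) = i.val + n + 1 := by
    have : (M : ℝ) = ((i.val + n + 1 : ℕ) : ℝ) := by rw [← hM]
    rw [this]; push_cast; ring
  have hxa : gX a b M (i.val + 1) - a = (i.val + 1) * gH a b M := by
    unfold gX; push_cast; ring
  have hxb : b - gX a b M (i.val + 1) = (n + 1) * gH a b M := by
    have := gH_mul (a := a) (b := b) M
    rw [hMr] at this
    unfold gX
    push_cast
    linear_combination -this
  have key := consistency_error_le hβ hlam hK.le hu.continuousOn hc h1 h2 h3 hK1 hK2 hK3 hg hug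
    (hgint _ hx) (hf _ hx) (gH_pos hab M) i.val n hxa hxb
  rw [← cB1_eq _ hx.1, ← cB2_eq _ hx.2, ← dd1_eq g _ hx.1, ← dd2_eq g _ hx.2] at key
  rw [stiff_mulVec, sum_offD_mul hab hβ (fun k => u (gX a b M k)) i hM,
    loadF_eq hab hβ f g u i hM, diagExtra_eq hab hβ hM hM3]
  have sL : ∑ j ∈ Finset.range i.val, nodeCoeff β lam (gH a b M) j
        * (u (gX a b M (i.val + 1)) - u (gX a b M (i.val - j)))
      = ∑ j ∈ Finset.range i.val, nodeCoeff β lam (gH a b M) j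
        * (u (gX a b M (i.val + 1))
          - u (gX a b M (i.val + 1) + (-1) * ((j + 1) * gH a b M))) := by
    refine Finset.sum_congr rfl fun j hj => ?_
    have hj' := (Finset.mem_range.1 hj).le
    congr 3
    unfold gX
    rw [Nat.cast_sub hj']
    push_cast
    ring
  have sR : ∑ j ∈ Finset.range n, nodeCoeff β lam (gH a b M) j
        * (u (gX a b M (i.val + 1)) - u (gX a b M (i.val + 1 + j + 1)))
      = ∑ j ∈ Finset.range n, nodeCoeff β lam (gH a b M) j
        * (u (gX a b M (i.val + 1))
          - u (gX a b M (i.val + 1) + 1 * ((j + 1) * gH a b M))) := by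
    refine Finset.sum_congr rfl fun j _ => ?_
    congr 3
    unfold gX
    push_cast
    ring
  rw [sL, sR]
  have ea : gX a b M (i.val + 1) + (-1) * ((i.val + 1) * gH a b M) = a := by
    rw [← hxa]; ring
  have eb : gX a b M (i.val + 1) + 1 * ((n + 1) * gH a b M) = b := by
    rw [← hxb]; ring
  rw [ea, eb] at key
  rw [← abs_neg]
  refine le_of_eq_of_le ?_ key
  congr 1
  ring

theorem dnorm2_le (hab : a < b) {v : Fin M → ℝ} {r : ℝ} (hr : 0 ≤ r) (hv : ∀ i, |v i| ≤ r) :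
    dnorm2 a b M v ≤ Real.sqrt (b - a) * r := by
  have hh := gH_pos hab M
  have hs : ∑ i, v i ^ 2 ≤ M * r ^ 2 := by
    have : ∑ i, v i ^ 2 ≤ ∑ _i : Fin M, r ^ 2 :=
      Finset.sum_le_sum fun i _ => sq_le_sq' (abs_le.1 (hv i)).1 (abs_le.1 (hv i)).2
    simpa using this
  have hM : (M : ℝ) * gH a b M ≤ b - a := by
    linarith [gH_mul (a := a) (b := b) M]
  calc dnorm2 a b M v ≤ Real.sqrt ((b - a) * r ^ 2) := by
        refine Real.sqrt_le_sqrt ?_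
        nlinarith [mul_le_mul_of_nonneg_left hs hh.le, sq_nonneg r,
          mul_le_mul_of_nonneg_right hM (sq_nonneg r)]
    _ = Real.sqrt (b - a) * r := by
        rw [Real.sqrt_mul (by linarith), Real.sqrt_sq hr]

end Scheme

end

noncomputable section

open MeasureTheory Set Filter

/-- convergence of the finite difference scheme, case `β ∈ (1,2)`, `s = s₁ = 1`,
`u ∈ C³([a,b])`: there are constants `C₁, C₂ > 0`, independent of `M` and `h`, such that for
every `M ≥ 3` the system `H U_h = F` has a unique solution `U_h`, with
`‖U − U_h‖ ≤ C₁ h^{3−β}` and `‖U − U_h‖_∞ ≤ C₂ h^{3−β}`. -/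
theorem scheme_convergence_beta_gt_one_s1 (a b β lam : ℝ)
    (hab : a < b) (hβ : β ∈ Set.Ioo (1 : ℝ) 2) (hlam : 0 ≤ lam)
    (u g f : ℝ → ℝ)
    (hu : ContDiffOn ℝ 3 u (Set.Icc a b))
    (hg : Measurable g)
    (hug : ∀ x, x ∉ Set.Ioo a b → u x = g x)
    (hgint : ∀ x ∈ Set.Ioo a b,
      IntegrableOn (fun y => |g y| * Real.exp (-lam * |x - y|) * |x - y| ^ (-1 - β))
        (Set.Ioo a b)ᶜ volume)
    (hf : ∀ x ∈ Set.Ioo a b,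
      Filter.Tendsto
        (fun ε : ℝ => ∫ y in {y : ℝ | ε < |x - y|},
          (u x - u y) * Real.exp (-lam * |x - y|) * |x - y| ^ (-1 - β))
        (nhdsWithin 0 (Set.Ioi 0)) (nhds (f x))) :
    ∃ C₁ > (0 : ℝ), ∃ C₂ > (0 : ℝ), ∀ M : ℕ, 3 ≤ M →
      (∃! Uh : Fin M → ℝ,
        (stiff a b β lam 1 1 M).mulVec Uh = loadF a b β lam 1 1 f g u M) ∧
      ∀ Uh : Fin M → ℝ,
        (stiff a b β lam 1 1 M).mulVec Uh = loadF a b β lam 1 1 f g u M →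
          dnorm2 a b M (fun i => u (gX a b M (i.val + 1)) - Uh i)
              ≤ C₁ * gH a b M ^ (3 - β) ∧
            ∀ i : Fin M, |u (gX a b M (i.val + 1)) - Uh i| ≤ C₂ * gH a b M ^ (3 - β) := by
  obtain ⟨C, hC, hres⟩ := exists_residual_bound hab hβ hlam hu hg hug hgint hf
  have hT := tailMass_pos hab (by linarith [hβ.1]) hlam (β := β)
  refine ⟨Real.sqrt (b - a) * (C / tailMass a b β lam),
    mul_pos (Real.sqrt_pos.2 (by linarith)) (by positivity), C / tailMass a b β lam,
    by positivity, fun M hM => ⟨?_, ?_⟩⟩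
  · have hunit := isUnit_stiff hab hβ hlam hM
    exact Function.Bijective.existsUnique ⟨Matrix.mulVec_injective_iff_isUnit.2 hunit,
      Matrix.mulVec_surjective_iff_isUnit.2 hunit⟩ _
  · intro Uh hUh
    have hpt : ∀ i : Fin M, |u (gX a b M (i.val + 1)) - Uh i|
        ≤ C / tailMass a b β lam * gH a b M ^ (3 - β) := by
      intro i
      rw [div_mul_eq_mul_div]
      refine abs_le_of_stiff_mulVec hab hβ hlam hM
        (e := (fun i : Fin M => u (gX a b M (i.val + 1))) - Uh) (fun i => ?_) i
      rw [Matrix.mulVec_sub, hUh]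
      exact hres M hM i
    refine ⟨?_, hpt⟩
    rw [mul_assoc]
    have := Real.rpow_nonneg (gH_pos hab M).le (3 - β)
    exact dnorm2_le hab (by positivity) hpt

end
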